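/- Let n ≥ 0 and α ≤ n be real, and let f ∈ T^α(ℝ). Then there exist finitely many tuples β^{(1)}, …, β^{(L)} ∈ ℝ^{n+1} with β^{(i)}_j ≤ 0 for all j and Σ_{j=0}^n β^{(i)}_j = α − n for each i, and functions φ_i ∈ S^{β^{(i)}_0}(ℝ) ⊠_i ⋯ ⊠_i S^{β^{(i)}_n}(ℝ) such that f^{[n]} = φ_1 + ⋯ + φ_L, where for all integers k_0, …, k_n ≥ 0 each φ_i satisfies ‖φ_i‖_{k_0,…,k_n} ≤ C · Σ_{r=0}^{n + k_0 + ⋯ + k_n + 2} ‖f‖_{T^α,r} with C independent of f. -/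

import Mathlib

open MeasureTheory Filter Topology
open scoped ENNReal NNReal

noncomputable section

/-- The Japanese bracket `⟨x⟩ = (1 + x²)^(1/2)`. -/
def jb (x : ℝ) : ℝ := Real.sqrt (1 + x ^ 2)

/-- The weight `‖f⁽ᵏ⁾(x)‖ ⟨x⟩^(k−β)` defining the `S^β` seminorms. -/
def sWeight (β : ℝ) (k : ℕ) (f : ℝ → ℂ) (x : ℝ) : ℝ :=
  ‖iteratedDeriv k f x‖ * jb x ^ ((k : ℝ) - β)

/-- The `S^β` seminorm `‖f‖_{S^β,k} = sup_x ‖f⁽ᵏ⁾(x)‖ ⟨x⟩^(k−β)`. -/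
def SNorm (β : ℝ) (k : ℕ) (f : ℝ → ℂ) : ℝ := ⨆ x : ℝ, sWeight β k f x

/-- Membership in `S^β(ℝ)`: smooth with all the seminorms finite. -/
def MemS (β : ℝ) (f : ℝ → ℂ) : Prop :=
  ContDiff ℝ (⊤ : ℕ∞) f ∧ ∀ k : ℕ, BddAbove (Set.range (sWeight β k f))

/-- The weight `‖f⁽ᵏ⁾(x)‖ ⟨x⟩^(k−β−1)` defining the `T^β` seminorms. -/
def tWeight (β : ℝ) (k : ℕ) (f : ℝ → ℂ) (x : ℝ) : ℝ :=
  ‖iteratedDeriv k f x‖ * jb x ^ ((k : ℝ) - β - 1)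

/-- The `T^β` seminorm `‖f‖_{T^β,k} = ∫ ‖f⁽ᵏ⁾(x)‖ ⟨x⟩^(k−β−1) dx`. -/
def TNorm (β : ℝ) (k : ℕ) (f : ℝ → ℂ) : ℝ := ∫ x : ℝ, tWeight β k f x

/-- Membership in `T^β(ℝ)`: smooth with all the seminorms finite. -/
def MemT (β : ℝ) (f : ℝ → ℂ) : Prop :=
  ContDiff ℝ (⊤ : ℕ∞) f ∧ ∀ k : ℕ, Integrable (tWeight β k f)

/-- `F` is the sequence of divided differences of `f`: `F 0 = f`, each `F m` is
continuous, and the divided-difference recursion holds off the diagonal. -/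
def IsDivDiff (f : ℝ → ℂ) (F : (m : ℕ) → (Fin (m + 1) → ℝ) → ℂ) : Prop :=
  (∀ x : Fin 1 → ℝ, F 0 x = f (x 0)) ∧
  (∀ m, Continuous (F m)) ∧
  (∀ m, ∀ x : Fin (m + 2) → ℝ, x 0 ≠ x (Fin.last (m + 1)) →
    F (m + 1) x = (F m (fun i => x i.succ) - F m (fun i => x i.castSucc)) /
      ((x 0 - x (Fin.last (m + 1)) : ℝ) : ℂ))

end
noncomputable section

open MeasureTheory
open scoped ENNReal

/-- `(Ω, mΩ, ν, a)` is an admissible integral representation of the symbol `φ`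
witnessing membership in `S^{β 0}(ℝ) ⊠ᵢ ⋯ ⊠ᵢ S^{β n}(ℝ)`. -/
def IsBoxRep {n : ℕ} (β : Fin (n + 1) → ℝ) (φ : (Fin (n + 1) → ℝ) → ℂ)
    (Ω : Type) (mΩ : MeasurableSpace Ω) (ν : @Measure Ω mΩ)
    (a : Fin (n + 1) → ℝ → Ω → ℂ) : Prop :=
  SigmaFinite ν ∧
  (∀ j, Measurable (Function.uncurry (a j))) ∧
  (∀ j ω, MemS (β j) (fun x => a j x ω)) ∧
  (∀ j k, Measurable fun ω => SNorm (β j) k (fun x => a j x ω)) ∧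
  (∀ lam : Fin (n + 1) → ℝ, φ lam = ∫ ω, ∏ j, a j (lam j) ω ∂ν) ∧
  (∀ k : Fin (n + 1) → ℕ,
    Integrable (fun ω => ∏ j, SNorm (β j) (k j) (fun x => a j x ω)) ν)

/-- Membership of `φ` in `S^{β 0}(ℝ) ⊠ᵢ ⋯ ⊠ᵢ S^{β n}(ℝ)`. -/
def MemBox {n : ℕ} (β : Fin (n + 1) → ℝ) (φ : (Fin (n + 1) → ℝ) → ℂ) : Prop :=
  ∃ (Ω : Type) (mΩ : MeasurableSpace Ω) (ν : @Measure Ω mΩ)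
    (a : Fin (n + 1) → ℝ → Ω → ℂ), IsBoxRep β φ Ω mΩ ν a

/-- The seminorm `‖φ‖_{k_0,…,k_n}` of `S^{β 0}(ℝ) ⊠ᵢ ⋯ ⊠ᵢ S^{β n}(ℝ)`: the infimum,
over all admissible representations, of `∫ ∏_j ‖a_j(·,ω)‖_{S^{β_j},k_j} dν(ω)`. -/
def boxNorm {n : ℕ} (β : Fin (n + 1) → ℝ) (k : Fin (n + 1) → ℕ)
    (φ : (Fin (n + 1) → ℝ) → ℂ) : ℝ≥0∞ :=
  sInf { M : ℝ≥0∞ | ∃ (Ω : Type) (mΩ : MeasurableSpace Ω) (ν : @Measure Ω mΩ)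
    (a : Fin (n + 1) → ℝ → Ω → ℂ), IsBoxRep β φ Ω mΩ ν a ∧
    M = ∫⁻ ω, ∏ j, ENNReal.ofReal (SNorm (β j) (k j) (fun x => a j x ω)) ∂ν }

end

/-! ### The Japanese bracket -/

theorem one_le_jb (x : ℝ) : 1 ≤ jb x :=
  Real.one_le_sqrt.mpr (by nlinarith [sq_nonneg x])

theorem jb_pos (x : ℝ) : 0 < jb x := zero_lt_one.trans_le (one_le_jb x)

theorem jb_ne_zero (x : ℝ) : jb x ≠ 0 := (jb_pos x).ne'

theorem abs_le_jb (x : ℝ) : |x| ≤ jb x := by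
  rw [← Real.sqrt_sq_eq_abs]
  exact Real.sqrt_le_sqrt (by linarith)

theorem continuous_jb : Continuous jb := by
  unfold jb
  fun_prop

theorem hasDerivAt_jb (x : ℝ) : HasDerivAt jb (x / jb x) x := by
  have h : HasDerivAt (fun y : ℝ => 1 + y ^ 2) (2 * x) x := by
    simpa using (hasDerivAt_pow 2 x).const_add 1
  have h2 := h.sqrt (by positivity)
  rwa [mul_div_mul_left _ _ two_ne_zero] at h2

theorem norm_add_I (x : ℝ) : ‖(x : ℂ) + Complex.I‖ = jb x := by
  rw [Complex.norm_eq_sqrt_sq_add_sq, jb]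
  simp [add_comm]

theorem norm_sub_neg_I (x : ℝ) : ‖(x : ℂ) - -Complex.I‖ = jb x := by
  rw [sub_neg_eq_add, norm_add_I]

theorem jb_le_add (x y : ℝ) : jb x ≤ jb y + |x - y| := by
  rw [← norm_add_I, ← norm_add_I, ← Complex.norm_real (x - y) |>.trans (Real.norm_eq_abs _)]
  refine le_trans (le_of_eq ?_) (norm_add_le _ _)
  congr 1
  push_cast
  ring

/-! ### Derivatives of powers of `x - z` -/

theorem ofReal_sub_ne_zero {z : ℂ} (hz : z.im ≠ 0) (x : ℝ) : (x : ℂ) - z ≠ 0 := by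
  intro h
  apply hz
  have := congrArg Complex.im h
  simpa using this

theorem abs_im_le_norm_ofReal_sub (z : ℂ) (x : ℝ) : |z.im| ≤ ‖(x : ℂ) - z‖ := by
  simpa using Complex.abs_im_le_norm ((x : ℂ) - z)

theorem contDiff_zpow_sub {z : ℂ} (hz : z.im ≠ 0) (m : ℤ) :
    ContDiff ℝ (⊤ : ℕ∞) (fun x : ℝ => ((x : ℂ) - z) ^ m) := by
  have hb : ContDiff ℝ (⊤ : ℕ∞) (fun x : ℝ => (x : ℂ) - z) :=
    Complex.ofRealCLM.contDiff.sub contDiff_const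
  cases m with
  | ofNat n => simpa using hb.pow n
  | negSucc n =>
    simp only [zpow_negSucc]
    exact (hb.pow _).inv fun x => pow_ne_zero _ (ofReal_sub_ne_zero hz x)

theorem iteratedDeriv_zpow_sub {z : ℂ} (hz : z.im ≠ 0) (m : ℤ) (k : ℕ) :
    iteratedDeriv k (fun x : ℝ => ((x : ℂ) - z) ^ m) =
      fun x : ℝ => (∏ i ∈ Finset.range k, ((m : ℂ) - i)) * ((x : ℂ) - z) ^ (m - k) := by
  induction k with
  | zero => simp
  | succ k ih =>
    rw [iteratedDeriv_succ, ih]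
    funext x
    have h1 : HasDerivAt (fun x : ℝ => (x : ℂ) - z) 1 x :=
      (Complex.ofRealCLM.hasDerivAt (x := x)).sub_const z
    have h2 := (hasDerivAt_zpow (m - k) ((x : ℂ) - z)
      (Or.inl (ofReal_sub_ne_zero hz x))).comp x h1
    have h3 := h2.const_mul (∏ i ∈ Finset.range k, ((m : ℂ) - i))
    rw [show (fun x : ℝ => (∏ i ∈ Finset.range k, ((m : ℂ) - i)) * ((x : ℂ) - z) ^ (m - k)) =
      (fun y : ℝ => (∏ i ∈ Finset.range k, ((m : ℂ) - i)) *
        ((fun x : ℂ => x ^ (m - (k : ℤ))) ∘ fun x : ℝ => (x : ℂ) - z) y) from rfl, h3.deriv,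
      Finset.prod_range_succ]
    push_cast
    rw [show m - (k : ℤ) - 1 = m - (k + 1) by ring]
    ring

theorem norm_prod_range_sub_le {m : ℤ} {P : ℕ} (hm : |m| ≤ P) {i k : ℕ} (hi : i ≤ k) :
    ‖∏ j ∈ Finset.range i, ((m : ℂ) - j)‖ ≤ ((P : ℝ) + k + 1) ^ k := by
  have h1 : ‖∏ j ∈ Finset.range i, ((m : ℂ) - j)‖ ≤ ((P : ℝ) + k + 1) ^ i := by
    rw [norm_prod]
    calc ∏ j ∈ Finset.range i, ‖(m : ℂ) - j‖
        ≤ ∏ _j ∈ Finset.range i, ((P : ℝ) + k + 1) := by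
          refine Finset.prod_le_prod (fun _ _ => norm_nonneg _) fun j hj => ?_
          refine (norm_sub_le _ _).trans ?_
          have h2 : ‖(m : ℂ)‖ ≤ P := by
            rw [Complex.norm_intCast]
            exact_mod_cast hm
          have h3 : ‖(j : ℂ)‖ ≤ k := by
            rw [Complex.norm_natCast]
            exact_mod_cast (Finset.mem_range.mp hj).le.trans hi
          linarith
      _ = _ := by simp
  refine h1.trans (pow_le_pow_right₀ ?_ hi)
  have := P.cast_nonneg (α := ℝ)
  have := k.cast_nonneg (α := ℝ)
  linarith

/-! ### The building blocks `(x + i)^(-p) (x - z)^(-e)` -/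

/-- The function `x ↦ (x + i)^(-p) (x - z)^(-e)`. -/
noncomputable def resolventBlock (p e : ℕ) (z : ℂ) (x : ℝ) : ℂ :=
  ((x : ℂ) - -Complex.I) ^ (-(p : ℤ)) * ((x : ℂ) - z) ^ (-(e : ℤ))

theorem neg_I_im_ne_zero : (-Complex.I).im ≠ 0 := by simp

theorem contDiff_resolventBlock (p e : ℕ) {z : ℂ} (hz : z.im ≠ 0) :
    ContDiff ℝ (⊤ : ℕ∞) (resolventBlock p e z) :=
  (contDiff_zpow_sub neg_I_im_ne_zero _).mul (contDiff_zpow_sub hz _)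

theorem jb_div_norm_sub_le {z : ℂ} (hz : z.im ≠ 0) (hzb : |z.im| ≤ jb z.re) (x : ℝ) :
    jb x / ‖(x : ℂ) - z‖ ≤ 2 * (jb z.re / |z.im|) := by
  have hn : 0 < ‖(x : ℂ) - z‖ := norm_pos_iff.mpr (ofReal_sub_ne_zero hz x)
  have hy : 0 < |z.im| := abs_pos.mpr hz
  have him := abs_im_le_norm_ofReal_sub z x
  have hre : |x - z.re| ≤ ‖(x : ℂ) - z‖ := by
    simpa using Complex.abs_re_le_norm ((x : ℂ) - z)
  rw [← mul_div_assoc, div_le_div_iff₀ hn hy]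
  have h1 := jb_le_add x z.re
  have hb := jb_pos z.re
  nlinarith [mul_le_mul_of_nonneg_right h1 hy.le, mul_le_mul_of_nonneg_left him hb.le,
    mul_le_mul hre hzb hy.le hn.le]

theorem jb_rpow_div_norm_sub_le {z : ℂ} (hz : z.im ≠ 0) (hzb : |z.im| ≤ jb z.re) {t : ℝ}
    (ht0 : 0 ≤ t) (ht1 : t ≤ 1) (x : ℝ) :
    jb x ^ t / ‖(x : ℂ) - z‖ ≤ 2 * (jb z.re ^ t / |z.im|) := by
  have hn : 0 < ‖(x : ℂ) - z‖ := norm_pos_iff.mpr (ofReal_sub_ne_zero hz x)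
  have hy : 0 < |z.im| := abs_pos.mpr hz
  have hb := jb_pos z.re
  have h1 : jb x ≤ 2 * (jb z.re / |z.im|) * ‖(x : ℂ) - z‖ :=
    (div_le_iff₀ hn).mp (jb_div_norm_sub_le hz hzb x)
  have h2 : ‖(x : ℂ) - z‖ ^ (t - 1) ≤ |z.im| ^ (t - 1) :=
    Real.rpow_le_rpow_of_nonpos hy (abs_im_le_norm_ofReal_sub z x) (by linarith)
  have h3 : (2 : ℝ) ^ t ≤ 2 := by
    simpa using Real.rpow_le_rpow_of_exponent_le (one_le_two (α := ℝ)) ht1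
  calc jb x ^ t / ‖(x : ℂ) - z‖
      ≤ (2 * (jb z.re / |z.im|) * ‖(x : ℂ) - z‖) ^ t / ‖(x : ℂ) - z‖ := by
        gcongr
        exact (jb_pos x).le
    _ = 2 ^ t * (jb z.re ^ t / |z.im| ^ t) * ‖(x : ℂ) - z‖ ^ (t - 1) := by
        rw [Real.mul_rpow (by positivity) hn.le, Real.mul_rpow (by positivity) (by positivity),
          Real.div_rpow hb.le hy.le, Real.rpow_sub_one hn.ne']
        ring
    _ ≤ 2 * (jb z.re ^ t / |z.im| ^ t) * |z.im| ^ (t - 1) := by gcongr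
    _ = 2 * (jb z.re ^ t / |z.im|) := by
        rw [Real.rpow_sub_one hy.ne']
        have := (Real.rpow_pos_of_pos hy t).ne'
        field_simp

/-- The constant in the bound for the `S`-seminorms of `resolventBlock`. -/
noncomputable def blockConst (P k : ℕ) : ℝ :=
  2 ^ k * (((P : ℝ) + k + 1) ^ k * ((1 : ℝ) + k + 1) ^ k) * 2 ^ (k + 1)

theorem blockConst_nonneg (P k : ℕ) : 0 ≤ blockConst P k := by
  unfold blockConst
  positivity

theorem norm_iteratedDeriv_zpow_sub_le {z : ℂ} (hz : z.im ≠ 0) {m : ℤ} {P : ℕ} (hm : |m| ≤ P)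
    {i k : ℕ} (hi : i ≤ k) (x : ℝ) :
    ‖iteratedDeriv i (fun x : ℝ => ((x : ℂ) - z) ^ m) x‖ ≤
      ((P : ℝ) + k + 1) ^ k * ‖(x : ℂ) - z‖ ^ (m - i) := by
  rw [iteratedDeriv_zpow_sub hz, norm_mul, norm_zpow]
  gcongr
  exact norm_prod_range_sub_le hm hi

theorem sWeight_resolventBlock_le {p P e : ℕ} (hp : p ≤ P) (he : e ≤ 1) {z : ℂ} (hz : z.im ≠ 0)
    (hzb : |z.im| ≤ jb z.re) {t : ℝ} (ht0 : 0 ≤ t) (ht1 : t ≤ 1) (k : ℕ) (x : ℝ) :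
    sWeight (-(p + e * t)) k (resolventBlock p e z) x ≤
      blockConst P k * ((jb z.re / |z.im|) ^ k * (jb z.re ^ t / |z.im|) ^ e) := by
  set n := ‖(x : ℂ) - z‖ with hn_def
  have hn : 0 < n := norm_pos_iff.mpr (ofReal_sub_ne_zero hz x)
  have hy : 0 < |z.im| := abs_pos.mpr hz
  have hb := jb_pos z.re
  have hx := jb_pos x
  have hby : 1 ≤ jb z.re / |z.im| := (one_le_div hy).mpr hzb
  set Q := (jb z.re / |z.im|) ^ k * (jb z.re ^ t / |z.im|) ^ e with hQ
  have key : ∀ i ∈ Finset.range (k + 1),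
      ‖(k.choose i : ℂ) * iteratedDeriv i (fun x : ℝ => ((x : ℂ) - -Complex.I) ^ (-(p : ℤ))) x *
        iteratedDeriv (k - i) (fun x : ℝ => ((x : ℂ) - z) ^ (-(e : ℤ))) x‖ *
        jb x ^ ((k : ℝ) - -(p + e * t)) ≤
      k.choose i * ((((P : ℝ) + k + 1) ^ k * ((1 : ℝ) + k + 1) ^ k) * 2 ^ (k + 1) * Q) := by
    intro i hi
    have hik : i ≤ k := Nat.lt_succ_iff.mp (Finset.mem_range.mp hi)
    rw [norm_mul, norm_mul, Complex.norm_natCast, mul_assoc, mul_assoc]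
    refine mul_le_mul_of_nonneg_left ?_ (Nat.cast_nonneg _)
    have h1 := norm_iteratedDeriv_zpow_sub_le neg_I_im_ne_zero (m := -(p : ℤ)) (P := P)
      (by simpa using hp) hik x
    have h2 := norm_iteratedDeriv_zpow_sub_le hz (m := -(e : ℤ)) (P := 1)
      (by simpa using he) (Nat.sub_le k i) x
    rw [norm_sub_neg_I] at h1
    rw [← hn_def] at h2
    push_cast at h2
    have h3 : jb x ^ (-(p : ℤ) - i) * (n ^ (-(e : ℤ) - ((k - i : ℕ) : ℤ)) *
        jb x ^ ((k : ℝ) - -(p + e * t))) = (jb x / n) ^ (k - i) * (jb x ^ t / n) ^ e := by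
      have e1 : jb x ^ ((k : ℝ) - -(p + e * t)) =
          jb x ^ ((k - i : ℕ) : ℤ) * jb x ^ ((i : ℤ) + p) * (jb x ^ t) ^ e := by
        rw [← Real.rpow_intCast, ← Real.rpow_intCast, ← Real.rpow_natCast (jb x ^ t),
          ← Real.rpow_mul hx.le, ← Real.rpow_add hx, ← Real.rpow_add hx]
        congr 1
        push_cast [Nat.cast_sub hik]
        ring
      have e2 : jb x ^ (-(p : ℤ) - i) * jb x ^ ((i : ℤ) + p) = 1 := by
        rw [← zpow_add₀ hx.ne', show -(p : ℤ) - i + (i + p) = 0 by ring, zpow_zero]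
      have e3 : n ^ (-(e : ℤ) - ((k - i : ℕ) : ℤ)) = (n ^ e)⁻¹ * (n ^ (k - i))⁻¹ := by
        rw [sub_eq_add_neg, zpow_add₀ hn.ne', zpow_neg, zpow_neg, zpow_natCast, zpow_natCast]
      rw [e1, e3, div_pow, div_pow, zpow_natCast]
      calc _ = (jb x ^ (-(p : ℤ) - i) * jb x ^ ((i : ℤ) + p)) *
            (jb x ^ (k - i) / n ^ (k - i) * ((jb x ^ t) ^ e / n ^ e)) := by
              simp only [div_eq_mul_inv]
              ring
        _ = _ := by rw [e2, one_mul]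
    have h4 : (jb x / n) ^ (k - i) * (jb x ^ t / n) ^ e ≤ 2 ^ (k + 1) * Q := by
      calc (jb x / n) ^ (k - i) * (jb x ^ t / n) ^ e
          ≤ (2 * (jb z.re / |z.im|)) ^ (k - i) * (2 * (jb z.re ^ t / |z.im|)) ^ e := by
            gcongr
            · exact jb_div_norm_sub_le hz hzb x
            · exact jb_rpow_div_norm_sub_le hz hzb ht0 ht1 x
        _ ≤ (2 * (jb z.re / |z.im|)) ^ k * (2 * (jb z.re ^ t / |z.im|)) ^ e := by
            gcongr
            · linarith
            · exact Nat.sub_le k i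
        _ = 2 ^ (k + e) * Q := by
            rw [hQ, mul_pow, mul_pow, pow_add]
            ring
        _ ≤ 2 ^ (k + 1) * Q := by
            gcongr
            exact one_le_two
    have hK0 : (0 : ℝ) ≤ (P : ℝ) + k + 1 := by positivity
    calc _ ≤ (((P : ℝ) + k + 1) ^ k * jb x ^ (-(p : ℤ) - i)) *
          ((((1 : ℝ) + k + 1) ^ k * n ^ (-(e : ℤ) - ((k - i : ℕ) : ℤ))) *
            jb x ^ ((k : ℝ) - -(p + e * t))) := by
            refine mul_le_mul h1 (mul_le_mul_of_nonneg_right (h2.trans ?_) (by positivity))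
              (by positivity) (by positivity)
            gcongr
      _ = (((P : ℝ) + k + 1) ^ k * ((1 : ℝ) + k + 1) ^ k) *
          (jb x ^ (-(p : ℤ) - i) * (n ^ (-(e : ℤ) - ((k - i : ℕ) : ℤ)) *
            jb x ^ ((k : ℝ) - -(p + e * t)))) := by ring
      _ ≤ _ := by
          rw [h3, mul_assoc (((P : ℝ) + k + 1) ^ k * ((1 : ℝ) + k + 1) ^ k)]
          gcongr
  have hmul : resolventBlock p e z = (fun x : ℝ => ((x : ℂ) - -Complex.I) ^ (-(p : ℤ))) *
      (fun x : ℝ => ((x : ℂ) - z) ^ (-(e : ℤ))) := rfl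
  have hle : ((k : ℕ) : WithTop ℕ∞) ≤ ((⊤ : ℕ∞) : WithTop ℕ∞) := by exact_mod_cast le_top
  rw [sWeight, hmul, iteratedDeriv_mul
    (((contDiff_zpow_sub neg_I_im_ne_zero _).of_le hle).contDiffAt)
    (((contDiff_zpow_sub hz _).of_le hle).contDiffAt)]
  calc _ ≤ (∑ i ∈ Finset.range (k + 1), ‖(k.choose i : ℂ) *
        iteratedDeriv i (fun x : ℝ => ((x : ℂ) - -Complex.I) ^ (-(p : ℤ))) x *
        iteratedDeriv (k - i) (fun x : ℝ => ((x : ℂ) - z) ^ (-(e : ℤ))) x‖) *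
        jb x ^ ((k : ℝ) - -(p + e * t)) := by
          gcongr
          exact norm_sum_le _ _
    _ ≤ ∑ i ∈ Finset.range (k + 1), (k.choose i : ℝ) *
        ((((P : ℝ) + k + 1) ^ k * ((1 : ℝ) + k + 1) ^ k) * 2 ^ (k + 1) * Q) := by
          rw [Finset.sum_mul]
          exact Finset.sum_le_sum key
    _ = blockConst P k * Q := by
          rw [← Finset.sum_mul, blockConst, ← Nat.cast_sum, Nat.sum_range_choose]
          push_cast
          ring

/-! ### The seminorms of `S^β` -/

theorem SNorm_nonneg (β : ℝ) (k : ℕ) (f : ℝ → ℂ) : 0 ≤ SNorm β k f :=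
  Real.iSup_nonneg fun x => mul_nonneg (norm_nonneg _) (Real.rpow_nonneg (jb_pos x).le _)

theorem sWeight_const_mul {f : ℝ → ℂ} (hf : ContDiff ℝ (⊤ : ℕ∞) f) (c : ℂ) (β : ℝ) (k : ℕ)
    (x : ℝ) : sWeight β k (fun y => c * f y) x = ‖c‖ * sWeight β k f x := by
  have hle : ((k : ℕ) : WithTop ℕ∞) ≤ ((⊤ : ℕ∞) : WithTop ℕ∞) := by exact_mod_cast le_top
  rw [sWeight, iteratedDeriv_const_mul c (hf.of_le hle).contDiffAt, norm_mul, mul_assoc, sWeight]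

theorem SNorm_const_mul {f : ℝ → ℂ} (hf : ContDiff ℝ (⊤ : ℕ∞) f) (c : ℂ) (β : ℝ) (k : ℕ) :
    SNorm β k (fun y => c * f y) = ‖c‖ * SNorm β k f := by
  simp only [SNorm, sWeight_const_mul hf]
  exact (Real.mul_iSup_of_nonneg (norm_nonneg c) _).symm

theorem MemS.const_mul {f : ℝ → ℂ} {β : ℝ} (hf : MemS β f) (c : ℂ) :
    MemS β (fun y => c * f y) := by
  refine ⟨contDiff_const.mul hf.1, fun k => ?_⟩
  obtain ⟨B, hB⟩ := hf.2 k
  refine ⟨‖c‖ * B, ?_⟩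
  rintro _ ⟨x, rfl⟩
  rw [sWeight_const_mul hf.1]
  exact mul_le_mul_of_nonneg_left (hB ⟨x, rfl⟩) (norm_nonneg c)

theorem continuous_sWeight {f : ℝ → ℂ} (hf : ContDiff ℝ (⊤ : ℕ∞) f) (β : ℝ) (k : ℕ) :
    Continuous (sWeight β k f) := by
  have hle : ((k : ℕ) : WithTop ℕ∞) ≤ ((⊤ : ℕ∞) : WithTop ℕ∞) := by exact_mod_cast le_top
  exact ((hf.continuous_iteratedDeriv k hle).norm).mul
    (continuous_jb.rpow_const fun x => Or.inl (jb_ne_zero x))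

theorem measurable_iteratedDeriv_uncurry {Ω : Type*} [MeasurableSpace Ω] {a : ℝ → Ω → ℂ}
    (ha : Measurable (Function.uncurry a)) (hs : ∀ ω, ContDiff ℝ (⊤ : ℕ∞) fun x => a x ω)
    (k : ℕ) : Measurable fun q : ℝ × Ω => iteratedDeriv k (fun x => a x q.2) q.1 := by
  induction k with
  | zero => simpa using! ha
  | succ k ih =>
    have hlt : ((k : ℕ) : WithTop ℕ∞) < ((⊤ : ℕ∞) : WithTop ℕ∞) := by
      exact_mod_cast ENat.natCast_lt_top k
    refine measurable_of_tendsto_metrizable (f := fun (n : ℕ) (q : ℝ × Ω) =>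
      ((1 / ((n : ℝ) + 1) : ℝ)⁻¹ : ℝ) • (iteratedDeriv k (fun x => a x q.2)
        (q.1 + 1 / ((n : ℝ) + 1)) - iteratedDeriv k (fun x => a x q.2) q.1)) (fun n => ?_) ?_
    · have h1 : Measurable fun q : ℝ × Ω => (q.1 + 1 / ((n : ℝ) + 1), q.2) := by fun_prop
      exact ((ih.comp h1).sub ih).const_smul ((1 / ((n : ℝ) + 1) : ℝ)⁻¹)
    · rw [tendsto_pi_nhds]
      intro q
      have hd : HasDerivAt (iteratedDeriv k fun x => a x q.2)
          (iteratedDeriv (k + 1) (fun x => a x q.2) q.1) q.1 := by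
        rw [iteratedDeriv_succ]
        exact ((hs q.2).differentiable_iteratedDeriv k hlt q.1).hasDerivAt
      refine (hasDerivAt_iff_tendsto_slope_zero.mp hd).comp ?_
      refine tendsto_nhdsWithin_iff.mpr ⟨tendsto_one_div_add_atTop_nhds_zero_nat, ?_⟩
      exact Eventually.of_forall fun n => by
        simp only [Set.mem_compl_iff, Set.mem_singleton_iff]
        positivity

theorem measurable_SNorm {Ω : Type*} [MeasurableSpace Ω] {a : ℝ → Ω → ℂ} {β : ℝ}
    (ha : Measurable (Function.uncurry a)) (hs : ∀ ω, MemS β fun x => a x ω) (k : ℕ) :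
    Measurable fun ω => SNorm β k (fun x => a x ω) := by
  have hc : Countable (Set.range ((↑) : ℚ → ℝ)) := (Set.countable_range _).to_subtype
  have h1 : ∀ ω, SNorm β k (fun x => a x ω) =
      ⨆ x : Set.range ((↑) : ℚ → ℝ), sWeight β k (fun x => a x ω) x := fun ω =>
    (Rat.denseRange_cast.ciSup (continuous_sWeight (hs ω).1 β k) ((hs ω).2 k)).symm
  simp only [h1]
  refine Measurable.iSup fun x => ?_
  have h3 := (measurable_iteratedDeriv_uncurry ha (fun ω => (hs ω).1) k).comp
    (measurable_prodMk_left (x := (x : ℝ)))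
  exact h3.norm.mul_const _

/-! ### Divided differences -/

/-- The division-free form of `IsDivDiff`, with the recursion valid also on the diagonal. -/
def IsDivDiffMul (g : ℝ → ℂ) (G : (m : ℕ) → (Fin (m + 1) → ℝ) → ℂ) : Prop :=
  (∀ x : Fin 1 → ℝ, G 0 x = g (x 0)) ∧
  (∀ m, Continuous (G m)) ∧
  (∀ m, ∀ x : Fin (m + 2) → ℝ,
    G (m + 1) x * ((x 0 : ℂ) - x (Fin.last (m + 1))) =
      G m (fun i => x i.succ) - G m (fun i => x i.castSucc))

theorem dense_head_ne_last (m : ℕ) :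
    Dense {x : Fin (m + 2) → ℝ | x 0 ≠ x (Fin.last (m + 1))} := by
  let φ : (Fin (m + 2) → ℝ) →ₗ[ℝ] ℝ :=
    LinearMap.proj (R := ℝ) (φ := fun _ => ℝ) 0 -
      LinearMap.proj (R := ℝ) (φ := fun _ => ℝ) (Fin.last (m + 1))
  have h1 : {x : Fin (m + 2) → ℝ | x 0 ≠ x (Fin.last (m + 1))} =
      ((LinearMap.ker φ : Submodule ℝ (Fin (m + 2) → ℝ)) : Set (Fin (m + 2) → ℝ))ᶜ := by
    ext x
    simp [φ, sub_eq_zero]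
  rw [h1, ← interior_eq_empty_iff_dense_compl]
  by_contra h2
  have h3 := Submodule.eq_top_of_nonempty_interior' _ (Set.nonempty_iff_ne_empty.mpr h2)
  have h4 : (Pi.single 0 1 : Fin (m + 2) → ℝ) ∈ LinearMap.ker φ := by
    rw [h3]
    trivial
  have h5 : Fin.last (m + 1) ≠ 0 := Fin.last_pos.ne'
  simp [φ, h5] at h4

theorem IsDivDiff.eq_of_isDivDiffMul {f : ℝ → ℂ} {F D : (m : ℕ) → (Fin (m + 1) → ℝ) → ℂ}
    (hF : IsDivDiff f F) (hD : IsDivDiffMul f D) (m : ℕ) : F m = D m := by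
  induction m with
  | zero =>
    funext x
    rw [hF.1, hD.1]
  | succ m ih =>
    refine Continuous.ext_on (dense_head_ne_last m) (hF.2.1 _) (hD.2.1 _) fun x hx => ?_
    have h1 : (x 0 : ℂ) - x (Fin.last (m + 1)) ≠ 0 := by
      rw [sub_ne_zero]
      exact_mod_cast hx
    rw [hF.2.2 m x hx, ih, ← hD.2.2 m x]
    push_cast
    rw [mul_div_cancel_right₀ _ h1]

theorem IsDivDiffMul.unique {f : ℝ → ℂ} {F D : (m : ℕ) → (Fin (m + 1) → ℝ) → ℂ}
    (hF : IsDivDiffMul f F) (hD : IsDivDiffMul f D) (m : ℕ) : F m = D m := by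
  refine IsDivDiff.eq_of_isDivDiffMul ⟨hF.1, hF.2.1, fun m x hx => ?_⟩ hD m
  have h1 : ((x 0 - x (Fin.last (m + 1)) : ℝ) : ℂ) ≠ 0 := by
    exact_mod_cast sub_ne_zero.mpr hx
  rw [eq_div_iff h1, ← hF.2.2 m x]
  push_cast
  rfl

/-- The divided differences of `x ↦ (x + i)⁻¹ g(x)` in terms of those of `g`. -/
noncomputable def divSeq (G : (m : ℕ) → (Fin (m + 1) → ℝ) → ℂ) :
    (m : ℕ) → (Fin (m + 1) → ℝ) → ℂ
  | 0, x => ((x 0 : ℂ) - -Complex.I)⁻¹ * G 0 x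
  | m + 1, x => ((x (Fin.last (m + 1)) : ℂ) - -Complex.I)⁻¹ *
      (G (m + 1) x + divSeq G m fun i => x i.castSucc)

theorem sub_neg_I_ne_zero (x : ℝ) : (x : ℂ) - -Complex.I ≠ 0 :=
  ofReal_sub_ne_zero neg_I_im_ne_zero x

theorem last_mul_divSeq (G : (m : ℕ) → (Fin (m + 1) → ℝ) → ℂ) (m : ℕ) (x : Fin (m + 2) → ℝ) :
    ((x (Fin.last (m + 1)) : ℂ) - -Complex.I) * divSeq G (m + 1) x =
      G (m + 1) x + divSeq G m fun i => x i.castSucc := by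
  rw [divSeq, mul_inv_cancel_left₀ (sub_neg_I_ne_zero _)]

theorem zero_mul_divSeq (G : (m : ℕ) → (Fin (m + 1) → ℝ) → ℂ) (x : Fin 1 → ℝ) :
    ((x 0 : ℂ) - -Complex.I) * divSeq G 0 x = G 0 x := by
  rw [divSeq, mul_inv_cancel_left₀ (sub_neg_I_ne_zero _)]

theorem IsDivDiffMul.head_mul_divSeq {g : ℝ → ℂ} {G : (m : ℕ) → (Fin (m + 1) → ℝ) → ℂ}
    (hG : IsDivDiffMul g G) (m : ℕ) (x : Fin (m + 2) → ℝ) :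
    ((x 0 : ℂ) - -Complex.I) * divSeq G (m + 1) x =
      G (m + 1) x + divSeq G m fun i => x i.succ := by
  refine mul_left_cancel₀ (sub_neg_I_ne_zero (x (Fin.last (m + 1)))) ?_
  rw [mul_left_comm, last_mul_divSeq]
  have h1 := hG.2.2 m x
  induction m with
  | zero =>
    have h2 := zero_mul_divSeq G fun i => x i.castSucc
    have h3 := zero_mul_divSeq G fun i => x i.succ
    simp only [Fin.castSucc_zero] at h2
    have h4 : Fin.succ (0 : Fin 1) = Fin.last (0 + 1) := rfl
    rw [h4] at h3
    linear_combination h2 - h3 + h1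
  | succ m ih =>
    have h2 := ih (fun i => x i.castSucc) (hG.2.2 m _)
    have h3 := last_mul_divSeq G m fun i => x i.succ
    have h4 := mul_left_cancel₀ (sub_neg_I_ne_zero (x (Fin.last (m + 1)).castSucc))
      ((mul_left_comm _ _ _).trans ((congrArg _ (last_mul_divSeq G m _)).trans h2))
    simp only [Fin.castSucc_zero, Fin.succ_last, ← Fin.succ_castSucc] at h3 h4
    linear_combination h4 - h3 + h1

theorem IsDivDiffMul.div {g : ℝ → ℂ} {G : (m : ℕ) → (Fin (m + 1) → ℝ) → ℂ}
    (hG : IsDivDiffMul g G) :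
    IsDivDiffMul (fun x => ((x : ℂ) - -Complex.I)⁻¹ * g x) (divSeq G) := by
  refine ⟨fun x => by rw [divSeq, hG.1], fun m => ?_, fun m x => ?_⟩
  · induction m with
    | zero =>
      refine Continuous.mul (Continuous.inv₀ (by fun_prop) fun x => sub_neg_I_ne_zero _) (hG.2.1 0)
    | succ m ih =>
      refine Continuous.mul (Continuous.inv₀ (by fun_prop) fun x => sub_neg_I_ne_zero _)
        ((hG.2.1 _).add (ih.comp (by fun_prop)))
  · linear_combination hG.head_mul_divSeq m x - last_mul_divSeq G m x

/-- The divided differences of `x ↦ (x + i) g(x)` in terms of those of `g`. -/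
noncomputable def mulSeq (G : (m : ℕ) → (Fin (m + 1) → ℝ) → ℂ) :
    (m : ℕ) → (Fin (m + 1) → ℝ) → ℂ
  | 0, x => ((x 0 : ℂ) - -Complex.I) * G 0 x
  | m + 1, x => ((x (Fin.last (m + 1)) : ℂ) - -Complex.I) * G (m + 1) x -
      G m fun i => x i.castSucc

theorem IsDivDiffMul.mul {g : ℝ → ℂ} {G : (m : ℕ) → (Fin (m + 1) → ℝ) → ℂ}
    (hG : IsDivDiffMul g G) :
    IsDivDiffMul (fun x => ((x : ℂ) - -Complex.I) * g x) (mulSeq G) := by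
  refine ⟨fun x => by rw [mulSeq, hG.1], fun m => ?_, fun m x => ?_⟩
  · have := hG.2.1
    cases m with
    | zero => exact Continuous.mul (by fun_prop) (this 0)
    | succ m =>
      exact (Continuous.mul (by fun_prop) (this (m + 1))).sub ((this m).comp (by fun_prop))
  · cases m with
    | zero =>
      have h1 := hG.2.2 0 x
      simp only [mulSeq, Fin.castSucc_zero]
      have h4 : Fin.succ (0 : Fin 1) = Fin.last (0 + 1) := rfl
      rw [h4]
      linear_combination ((x (Fin.last (0 + 1)) : ℂ) - -Complex.I) * h1
    | succ m =>
      have h1 := hG.2.2 (m + 1) x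
      have h2 := hG.2.2 m fun i => x i.castSucc
      simp only [mulSeq, Fin.castSucc_zero, Fin.succ_last, ← Fin.succ_castSucc] at h2 ⊢
      linear_combination ((x (Fin.last (m + 1 + 1)) : ℂ) - -Complex.I) * h1 - h2

/-! ### Divided differences after repeated division -/

/-- A term `G l (x_0, …, x_l) ∏ j, (x_j + i)^(-p_j)`. -/
noncomputable def divTerm (G : (m : ℕ) → (Fin (m + 1) → ℝ) → ℂ) {n : ℕ}
    (τ : Fin (n + 1) × (Fin (n + 1) → ℕ)) (x : Fin (n + 1) → ℝ) : ℂ :=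
  G τ.1 (fun j => x (Fin.castLE τ.1.2 j)) * ∏ j, ((x j : ℂ) - -Complex.I) ^ (-(τ.2 j : ℤ))

theorem inv_last_mul_divTerm (G : (m : ℕ) → (Fin (m + 1) → ℝ) → ℂ) {n : ℕ}
    (τ : Fin (n + 1) × (Fin (n + 1) → ℕ)) (x : Fin (n + 1) → ℝ) :
    ((x (Fin.last n) : ℂ) - -Complex.I)⁻¹ * divTerm G τ x =
      divTerm G (τ.1, τ.2 + Pi.single (Fin.last n) 1) x := by
  rw [divTerm, divTerm, mul_left_comm]
  congr 1
  rw [Fin.prod_univ_castSucc, Fin.prod_univ_castSucc, mul_left_comm]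
  congr 1
  · refine Finset.prod_congr rfl fun j _ => ?_
    simp
  · rw [← zpow_neg_one, ← zpow_add₀ (sub_neg_I_ne_zero _)]
    congr 1
    simp

theorem divTerm_castSucc (G : (m : ℕ) → (Fin (m + 1) → ℝ) → ℂ) {n : ℕ}
    (τ : Fin (n + 1) × (Fin (n + 1) → ℕ)) (x : Fin (n + 2) → ℝ) :
    divTerm G τ (fun i => x i.castSucc) =
      divTerm G (τ.1.castSucc, (Fin.snoc τ.2 0 : Fin (n + 2) → ℕ)) x := by
  rw [divTerm, divTerm]
  congr 1
  rw [Fin.prod_univ_castSucc (n := n + 1)]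
  simp only [Fin.snoc_castSucc, Fin.snoc_last, Nat.cast_zero, neg_zero, zpow_zero, mul_one]

theorem exists_divTerm_sum (G : (m : ℕ) → (Fin (m + 1) → ℝ) → ℂ) (s n : ℕ) :
    ∃ T : List (Fin (n + 1) × (Fin (n + 1) → ℕ)),
      (∀ τ ∈ T, ∑ j, τ.2 j + τ.1 = s + n) ∧
      ∀ x, divSeq^[s] G n x = (T.map fun τ => divTerm G τ x).sum := by
  induction s generalizing n with
  | zero => exact ⟨[(Fin.last n, 0)], by simp, fun x => by simp [divTerm]⟩
  | succ s ih =>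
    have hlast : ∀ {n : ℕ} (T : List (Fin (n + 1) × (Fin (n + 1) → ℕ))) (x : Fin (n + 1) → ℝ),
        ((x (Fin.last n) : ℂ) - -Complex.I)⁻¹ * (T.map fun τ => divTerm G τ x).sum =
        ((T.map fun τ => (τ.1, τ.2 + Pi.single (Fin.last n) 1)).map
          fun τ => divTerm G τ x).sum := by
      intro n T x
      rw [← List.sum_map_mul_left, List.map_map]
      simp only [inv_last_mul_divTerm, Function.comp_def]
    have hsum : ∀ {n r : ℕ} (T : List (Fin (n + 1) × (Fin (n + 1) → ℕ))),
        (∀ τ ∈ T, ∑ j, τ.2 j + τ.1 = r) →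
        ∀ τ ∈ T.map fun τ => ((τ.1, τ.2 + Pi.single (Fin.last n) 1) :
            Fin (n + 1) × (Fin (n + 1) → ℕ)),
          ∑ j, τ.2 j + τ.1 = r + 1 := by
      intro n r T hT τ hτ
      obtain ⟨σ, hσ, rfl⟩ := List.mem_map.mp hτ
      have := hT σ hσ
      simp only [Pi.add_apply, Finset.sum_add_distrib, Finset.sum_pi_single', Finset.mem_univ,
        if_true]
      omega
    rw [Function.iterate_succ_apply']
    induction n with
    | zero =>
      obtain ⟨T, hT, hx⟩ := ih 0
      refine ⟨_, hsum T hT, fun x => ?_⟩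
      rw [← hlast, ← hx, divSeq]
      rfl
    | succ n ihn =>
      obtain ⟨T, hT, hx⟩ := ih (n + 1)
      obtain ⟨T', hT', hx'⟩ := ihn
      have hT'' : ∀ τ ∈ T ++ T'.map (fun τ => (τ.1.castSucc, (Fin.snoc τ.2 0 : Fin (n + 2) → ℕ))),
          ∑ j, τ.2 j + τ.1 = s + (n + 1) := by
        intro τ hτ
        rcases List.mem_append.mp hτ with h | h
        · exact hT τ h
        · obtain ⟨σ, hσ, rfl⟩ := List.mem_map.mp h
          have := hT' σ hσ
          rw [Fin.sum_univ_castSucc]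
          simp only [Fin.snoc_castSucc, Fin.snoc_last, Fin.val_castSucc]
          omega
      refine ⟨_, fun τ hτ => (hsum _ hT'' τ hτ).trans (by omega), fun x => ?_⟩
      rw [← hlast, List.map_append, List.sum_append, ← hx, divSeq, hx', List.map_map]
      simp only [divTerm_castSucc, Function.comp_def]

/-! ### Cauchy-type representations -/

/-- The weight `⟨Re z⟩^(K - 1 - a) |Im z|^(-K)`. -/
noncomputable def cauchyWeight (a : ℝ) (K : ℕ) (z : ℂ) : ℝ :=
  jb z.re ^ ((K : ℝ) - 1 - a) * (|z.im| ^ K)⁻¹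

theorem cauchyWeight_nonneg (a : ℝ) (K : ℕ) (z : ℂ) : 0 ≤ cauchyWeight a K z :=
  mul_nonneg (Real.rpow_nonneg (jb_pos _).le _) (by positivity)

/-- A representation `g(x) = ∫ w(ω) (x - z(ω))⁻¹ dν(ω)` by resolvents, absolutely convergent
after arbitrarily many differentiations with respect to `x`. -/
structure IsCauchyRep (a : ℝ) (g : ℝ → ℂ) {Ω : Type} [MeasurableSpace Ω] (ν : Measure Ω)
    (z w : Ω → ℂ) : Prop where
  sigmaFinite : SigmaFinite ν
  measurable_z : Measurable z
  measurable_w : Measurable w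
  im_ne_zero : ∀ ω, (z ω).im ≠ 0
  abs_im_le : ∀ ω, |(z ω).im| ≤ jb (z ω).re
  integrable : ∀ K : ℕ, 1 ≤ K → Integrable (fun ω => ‖w ω‖ * cauchyWeight a K (z ω)) ν
  eq_integral : ∀ x : ℝ, g x = ∫ ω, w ω * ((x : ℂ) - z ω)⁻¹ ∂ν

/-- The divided differences of `∫ w (x - z)⁻¹ dν`. -/
noncomputable def cauchySeq {Ω : Type} [MeasurableSpace Ω] (ν : Measure Ω) (z w : Ω → ℂ) (m : ℕ)
    (x : Fin (m + 1) → ℝ) : ℂ :=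
  ∫ ω, w ω * ∏ j, ((x j : ℂ) - z ω)⁻¹ ∂ν

theorem norm_add_I_le {z : ℂ} (hzb : |z.im| ≤ jb z.re) : ‖z - -Complex.I‖ ≤ 2 * jb z.re := by
  have h1 : z - -Complex.I = ((z.re : ℂ) + Complex.I) + (z.im : ℂ) * Complex.I := by
    apply Complex.ext <;> simp [add_comm]
  rw [h1]
  refine (norm_add_le _ _).trans ?_
  rw [norm_add_I, norm_mul, Complex.norm_real, Complex.norm_I, mul_one, Real.norm_eq_abs]
  linarith

theorem norm_pow_mul_prod_le {a : ℝ} (ha : a ≤ 0) {z : ℂ} (hz : z.im ≠ 0)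
    (hzb : |z.im| ≤ jb z.re) {q m : ℕ} (hqm : q ≤ m) (x : Fin (m + 1) → ℝ) :
    ‖(z - -Complex.I) ^ q * ∏ j, ((x j : ℂ) - z)⁻¹‖ ≤ 2 ^ q * cauchyWeight a (m + 1) z := by
  have hy : 0 < |z.im| := abs_pos.mpr hz
  have h1 : ‖∏ j, ((x j : ℂ) - z)⁻¹‖ ≤ (|z.im| ^ (m + 1))⁻¹ := by
    rw [norm_prod]
    calc ∏ j, ‖((x j : ℂ) - z)⁻¹‖ ≤ ∏ _j : Fin (m + 1), |z.im|⁻¹ := by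
          refine Finset.prod_le_prod (fun _ _ => norm_nonneg _) fun j _ => ?_
          rw [norm_inv]
          exact inv_anti₀ hy (abs_im_le_norm_ofReal_sub z _)
      _ = _ := by simp
  have h2 : jb z.re ^ q ≤ jb z.re ^ (((m + 1 : ℕ) : ℝ) - 1 - a) := by
    rw [← Real.rpow_natCast]
    refine Real.rpow_le_rpow_of_exponent_le (one_le_jb _) ?_
    have : (q : ℝ) ≤ m := by exact_mod_cast hqm
    push_cast
    linarith
  rw [norm_mul, norm_pow]
  calc _ ≤ (2 * jb z.re) ^ q * (|z.im| ^ (m + 1))⁻¹ := by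
        gcongr
        · have := (jb_pos z.re).le
          positivity
        · exact norm_add_I_le hzb
    _ = 2 ^ q * (jb z.re ^ q * (|z.im| ^ (m + 1))⁻¹) := by rw [mul_pow]; ring
    _ ≤ _ := by
        unfold cauchyWeight
        gcongr

section

variable {a : ℝ} {g : ℝ → ℂ} {Ω : Type} [MeasurableSpace Ω] {ν : Measure Ω} {z w : Ω → ℂ}

theorem IsCauchyRep.integrable_pow_mul_prod (h : IsCauchyRep a g ν z w) (ha : a ≤ 0) {q m : ℕ}
    (hqm : q ≤ m) (x : Fin (m + 1) → ℝ) :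
    Integrable (fun ω => w ω * (z ω - -Complex.I) ^ q * ∏ j, ((x j : ℂ) - z ω)⁻¹) ν := by
  have hz := h.measurable_z
  have hw := h.measurable_w
  refine Integrable.mono' ((h.integrable (m + 1) (by omega)).const_mul (2 ^ q))
    (Measurable.aestronglyMeasurable ?_) (Eventually.of_forall fun ω => ?_)
  · exact (hw.mul ((hz.sub_const _).pow_const _)).mul
      (Finset.measurable_fun_prod _ fun j _ => (hz.const_sub _).inv)
  · rw [mul_assoc, norm_mul, mul_left_comm]
    exact mul_le_mul_of_nonneg_left
      (norm_pow_mul_prod_le ha (h.im_ne_zero ω) (h.abs_im_le ω) hqm x) (norm_nonneg _)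

theorem prod_inv_mul_sub {m : ℕ} (x : Fin (m + 2) → ℝ) {z : ℂ} (hz : z.im ≠ 0) :
    (∏ j, ((x j : ℂ) - z)⁻¹) * ((x 0 : ℂ) - z) = ∏ j : Fin (m + 1), ((x j.succ : ℂ) - z)⁻¹ := by
  rw [Fin.prod_univ_succ, mul_comm, mul_inv_cancel_left₀ (ofReal_sub_ne_zero hz _)]

theorem prod_inv_mul_sub_last {m : ℕ} (x : Fin (m + 2) → ℝ) {z : ℂ} (hz : z.im ≠ 0) :
    (∏ j, ((x j : ℂ) - z)⁻¹) * ((x (Fin.last (m + 1)) : ℂ) - z) =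
      ∏ j : Fin (m + 1), ((x j.castSucc : ℂ) - z)⁻¹ := by
  rw [Fin.prod_univ_castSucc, inv_mul_cancel_right₀ (ofReal_sub_ne_zero hz _)]

theorem IsCauchyRep.isDivDiffMul (h : IsCauchyRep a g ν z w) (ha : a ≤ 0) :
    IsDivDiffMul g (cauchySeq ν z w) := by
  have hint : ∀ {m : ℕ} (x : Fin (m + 1) → ℝ),
      Integrable (fun ω => w ω * ∏ j, ((x j : ℂ) - z ω)⁻¹) ν := fun {m} x => by
    simpa using h.integrable_pow_mul_prod ha (Nat.zero_le m) x
  refine ⟨fun x => ?_, fun m => ?_, fun m x => ?_⟩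
  · rw [h.eq_integral]
    simp [cauchySeq]
  · refine continuous_of_dominated (fun x => (hint x).aestronglyMeasurable)
      (bound := fun ω => ‖w ω‖ * cauchyWeight a (m + 1) (z ω))
      (fun x => Eventually.of_forall fun ω => ?_) (h.integrable (m + 1) (by omega))
      (Eventually.of_forall fun ω => ?_)
    · rw [norm_mul]
      refine mul_le_mul_of_nonneg_left ?_ (norm_nonneg _)
      simpa using norm_pow_mul_prod_le ha (h.im_ne_zero ω) (h.abs_im_le ω) (Nat.zero_le m) x
    · refine continuous_const.mul (continuous_finsetProd _ fun j _ => ?_)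
      exact Continuous.inv₀ (by fun_prop) fun x => ofReal_sub_ne_zero (h.im_ne_zero ω) _
  · rw [cauchySeq, cauchySeq, cauchySeq, ← integral_sub (hint _) (hint _), ← integral_mul_const]
    refine integral_congr_ae (Eventually.of_forall fun ω => ?_)
    simp only
    rw [← prod_inv_mul_sub x (h.im_ne_zero ω), ← prod_inv_mul_sub_last x (h.im_ne_zero ω)]
    ring

theorem IsCauchyRep.iterate_mulSeq (h : IsCauchyRep a g ν z w) (ha : a ≤ 0) {q n : ℕ}
    (hqn : q ≤ n) (x : Fin (n + 1) → ℝ) :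
    mulSeq^[q] (cauchySeq ν z w) n x =
      ∫ ω, w ω * (z ω - -Complex.I) ^ q * ∏ j, ((x j : ℂ) - z ω)⁻¹ ∂ν := by
  induction q generalizing n with
  | zero => simp [cauchySeq]
  | succ q ih =>
    obtain ⟨n, rfl⟩ : ∃ n', n = n' + 1 := ⟨n - 1, by omega⟩
    rw [Function.iterate_succ_apply', mulSeq, ih (by omega), ih (by omega),
      ← integral_const_mul, ← integral_sub ((h.integrable_pow_mul_prod ha (by omega) x).const_mul _)
        (h.integrable_pow_mul_prod ha (by omega) _)]
    refine integral_congr_ae (Eventually.of_forall fun ω => ?_)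
    simp only
    rw [← prod_inv_mul_sub_last x (h.im_ne_zero ω)]
    ring

end

/-! ### Box representations from Cauchy-type representations -/

theorem memS_resolventBlock {p e : ℕ} (he : e ≤ 1) {z : ℂ} (hz : z.im ≠ 0)
    (hzb : |z.im| ≤ jb z.re) {t : ℝ} (ht0 : 0 ≤ t) (ht1 : t ≤ 1) :
    MemS (-(p + e * t)) (resolventBlock p e z) := by
  refine ⟨contDiff_resolventBlock p e hz, fun k =>
    ⟨blockConst p k * ((jb z.re / |z.im|) ^ k * (jb z.re ^ t / |z.im|) ^ e), ?_⟩⟩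
  rintro _ ⟨x, rfl⟩
  exact sWeight_resolventBlock_le le_rfl he hz hzb ht0 ht1 k x

theorem SNorm_resolventBlock_le {p P e : ℕ} (hp : p ≤ P) (he : e ≤ 1) {z : ℂ} (hz : z.im ≠ 0)
    (hzb : |z.im| ≤ jb z.re) {t : ℝ} (ht0 : 0 ≤ t) (ht1 : t ≤ 1) (k : ℕ) :
    SNorm (-(p + e * t)) k (resolventBlock p e z) ≤
      blockConst P k * ((jb z.re / |z.im|) ^ k * (jb z.re ^ t / |z.im|) ^ e) :=
  ciSup_le fun x => sWeight_resolventBlock_le hp he hz hzb ht0 ht1 k x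

theorem boxNorm_le_lintegral {n : ℕ} {β : Fin (n + 1) → ℝ} {φ : (Fin (n + 1) → ℝ) → ℂ} {Ω : Type}
    {mΩ : MeasurableSpace Ω} {ν : Measure Ω} {a : Fin (n + 1) → ℝ → Ω → ℂ}
    (h : IsBoxRep β φ Ω mΩ ν a) (k : Fin (n + 1) → ℕ) :
    boxNorm β k φ ≤ ∫⁻ ω, ∏ j, ENNReal.ofReal (SNorm (β j) (k j) (fun x => a j x ω)) ∂ν :=
  sInf_le ⟨Ω, mΩ, ν, a, h, rfl⟩

/-- The factor `x ↦ w (z + i)^q (x + i)^(-p) (x - z)^(-e)` (without the prefactor unless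
`j = 0`). -/
noncomputable def boxFactor {Ω : Type} {n : ℕ} (z w : Ω → ℂ) (q : ℕ) (p e : Fin (n + 1) → ℕ)
    (j : Fin (n + 1)) (x : ℝ) (ω : Ω) : ℂ :=
  (if j = 0 then w ω * (z ω - -Complex.I) ^ q else 1) * resolventBlock (p j) (e j) (z ω) x

section

variable {a : ℝ} {Ω : Type} {z w : Ω → ℂ} {n q P : ℕ} {p e : Fin (n + 1) → ℕ} {t : ℝ}

theorem prod_SNorm_boxFactor_le (hp : ∀ j, p j ≤ P) (he : ∀ j, e j ≤ 1) (ht0 : 0 ≤ t)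
    (ht1 : t ≤ 1) (hE : (∑ j, e j : ℕ) * t = (∑ j, e j : ℕ) - 1 - a - q) {ω : Ω}
    (hz : (z ω).im ≠ 0) (hzb : |(z ω).im| ≤ jb (z ω).re) (k : Fin (n + 1) → ℕ) :
    ∏ j, SNorm (-(p j + e j * t)) (k j) (fun x => boxFactor z w q p e j x ω) ≤
      (2 ^ q * ∏ j, blockConst P (k j)) *
        (‖w ω‖ * cauchyWeight a (∑ j, k j + ∑ j, e j) (z ω)) := by
  have hb := jb_pos (z ω).re
  have hy : 0 < |(z ω).im| := abs_pos.mpr hz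
  have h1 : ∀ j, SNorm (-(p j + e j * t)) (k j) (fun x => boxFactor z w q p e j x ω) =
      (if j = 0 then ‖w ω * (z ω - -Complex.I) ^ q‖ else 1) *
        SNorm (-(p j + e j * t)) (k j) (resolventBlock (p j) (e j) (z ω)) := by
    intro j
    simp only [boxFactor]
    rw [SNorm_const_mul (contDiff_resolventBlock _ _ hz)]
    split_ifs <;> simp
  simp only [h1]
  rw [Finset.prod_mul_distrib, Finset.prod_ite_eq' Finset.univ (0 : Fin (n + 1)),
    if_pos (Finset.mem_univ _), norm_mul, norm_pow]
  calc _ ≤ ‖w ω‖ * (2 * jb (z ω).re) ^ q * ∏ j, (blockConst P (k j) *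
        ((jb (z ω).re / |(z ω).im|) ^ k j * (jb (z ω).re ^ t / |(z ω).im|) ^ e j)) := by
        refine mul_le_mul ?_ (Finset.prod_le_prod (fun j _ => SNorm_nonneg _ _ _) fun j _ =>
          SNorm_resolventBlock_le (hp j) (he j) hz hzb ht0 ht1 (k j))
          (Finset.prod_nonneg fun j _ => SNorm_nonneg _ _ _) (by positivity)
        gcongr
        exact norm_add_I_le hzb
    _ = (2 ^ q * ∏ j, blockConst P (k j)) * (‖w ω‖ *
        (jb (z ω).re ^ q * (jb (z ω).re ^ (∑ j, k j) * (jb (z ω).re ^ t) ^ (∑ j, e j)) *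
          ((|(z ω).im| ^ (∑ j, k j))⁻¹ * (|(z ω).im| ^ (∑ j, e j))⁻¹))) := by
        rw [Finset.prod_mul_distrib, Finset.prod_mul_distrib, Finset.prod_pow_eq_pow_sum,
          Finset.prod_pow_eq_pow_sum, div_pow, div_pow, mul_pow]
        ring
    _ = _ := by
        rw [cauchyWeight, pow_add, mul_inv, ← Real.rpow_natCast (jb (z ω).re ^ t),
          ← Real.rpow_mul hb.le, ← Real.rpow_natCast (jb (z ω).re) q,
          ← Real.rpow_natCast (jb (z ω).re) (∑ j, k j), ← Real.rpow_add hb, ← Real.rpow_add hb]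
        congr 4
        have h2 : t * (∑ j, e j : ℕ) = (∑ j, e j : ℕ) - 1 - a - q := by rw [mul_comm, hE]
        rw [h2]
        push_cast
        ring

variable [MeasurableSpace Ω] {g : ℝ → ℂ} {ν : Measure Ω}

theorem IsCauchyRep.isBoxRep (h : IsCauchyRep a g ν z w) (he : ∀ j, e j ≤ 1) (ht0 : 0 ≤ t)
    (ht1 : t ≤ 1) (hE1 : 1 ≤ ∑ j, e j)
    (hE : (∑ j, e j : ℕ) * t = (∑ j, e j : ℕ) - 1 - a - q) :
    IsBoxRep (fun j => -(p j + e j * t))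
      (fun x => ∫ ω, w ω * (z ω - -Complex.I) ^ q * ∏ j, resolventBlock (p j) (e j) (z ω) (x j) ∂ν)
      Ω inferInstance ν (boxFactor z w q p e) := by
  have hz := h.measurable_z
  have hw := h.measurable_w
  have hm : ∀ j, Measurable (Function.uncurry (boxFactor z w q p e j)) := by
    intro j
    have h1 : Measurable fun y : ℝ × Ω => resolventBlock (p j) (e j) (z y.2) y.1 := by
      simp only [resolventBlock, zpow_neg, zpow_natCast]
      fun_prop
    have h2 : Measurable fun y : ℝ × Ω =>
        if j = 0 then w y.2 * (z y.2 - -Complex.I) ^ q else 1 := by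
      split_ifs <;> fun_prop
    exact h2.mul h1
  have hS : ∀ j ω, MemS (-(p j + e j * t)) fun x => boxFactor z w q p e j x ω := fun j ω =>
    (memS_resolventBlock (he j) (h.im_ne_zero ω) (h.abs_im_le ω) ht0 ht1).const_mul _
  have hN : ∀ j k, Measurable fun ω =>
      SNorm (-(p j + e j * t)) k (fun x => boxFactor z w q p e j x ω) := fun j k =>
    measurable_SNorm (hm j) (hS j) k
  refine ⟨h.sigmaFinite, hm, hS, hN, fun x => ?_, fun k => ?_⟩
  · refine integral_congr_ae (Eventually.of_forall fun ω => ?_)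
    simp only [boxFactor]
    rw [Finset.prod_mul_distrib, Finset.prod_ite_eq' Finset.univ (0 : Fin (n + 1)),
      if_pos (Finset.mem_univ _)]
  · refine Integrable.mono' ((h.integrable (∑ j, k j + ∑ j, e j) (by omega)).const_mul
      (2 ^ q * ∏ j, blockConst (∑ j, p j) (k j)))
      (Finset.measurable_fun_prod _ fun j _ => hN j (k j)).aestronglyMeasurable
      (Eventually.of_forall fun ω => ?_)
    rw [Real.norm_of_nonneg (Finset.prod_nonneg fun j _ => SNorm_nonneg _ _ _)]
    exact prod_SNorm_boxFactor_le
      (fun j => Finset.single_le_sum (fun _ _ => Nat.zero_le _) (Finset.mem_univ j)) he ht0 ht1 hE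
      (h.im_ne_zero ω) (h.abs_im_le ω) k

theorem IsCauchyRep.boxNorm_le (h : IsCauchyRep a g ν z w) (hp : ∀ j, p j ≤ P)
    (he : ∀ j, e j ≤ 1) (ht0 : 0 ≤ t) (ht1 : t ≤ 1) (hE1 : 1 ≤ ∑ j, e j)
    (hE : (∑ j, e j : ℕ) * t = (∑ j, e j : ℕ) - 1 - a - q) (k : Fin (n + 1) → ℕ) :
    boxNorm (fun j => -(p j + e j * t)) k
      (fun x => ∫ ω, w ω * (z ω - -Complex.I) ^ q *
        ∏ j, resolventBlock (p j) (e j) (z ω) (x j) ∂ν) ≤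
      ENNReal.ofReal (2 ^ q * ∏ j, blockConst P (k j)) *
        ∫⁻ ω, ENNReal.ofReal (‖w ω‖ * cauchyWeight a (∑ j, k j + ∑ j, e j) (z ω)) ∂ν := by
  refine (boxNorm_le_lintegral (h.isBoxRep he ht0 ht1 hE1 hE) k).trans ?_
  rw [← lintegral_const_mul' _ _ ENNReal.ofReal_ne_top]
  refine lintegral_mono fun ω => ?_
  rw [← ENNReal.ofReal_prod_of_nonneg fun j _ => SNorm_nonneg _ _ _, ← ENNReal.ofReal_mul]
  · exact ENNReal.ofReal_le_ofReal
      (prod_SNorm_boxFactor_le hp he ht0 ht1 hE (h.im_ne_zero ω) (h.abs_im_le ω) k)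
  · exact mul_nonneg (by positivity) (Finset.prod_nonneg fun j _ => blockConst_nonneg _ _)

end

/-! ### The kernels of the Cauchy-type formula -/

/-- The half-height `i ε ⟨x⟩` of the strip over `x`. -/
noncomputable def stripHeight (ε x : ℝ) : ℂ := Complex.I * ((ε * jb x : ℝ) : ℂ)

/-- The kernel `∫ u^r / r! (lam - x - u)⁻¹ du` over the segment from `-iε⟨x⟩` to `iε⟨x⟩`, in
closed form; see `cauchyKernel_eq_integral`. -/
noncomputable def cauchyKernel (ε lam : ℝ) : ℕ → ℝ → ℂ
  | 0, x => 2 * Complex.I * (Real.arctan (ε * jb x / (lam - x)) : ℂ)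
  | r + 1, x => (((lam - x : ℝ) : ℂ) * cauchyKernel ε lam r x -
      (stripHeight ε x ^ (r + 1) - (-stripHeight ε x) ^ (r + 1)) / ((r + 1).factorial : ℂ)) /
        ((r + 1 : ℕ) : ℂ)

/-- The contribution of one end `u` of the segment to the derivative of `cauchyKernel`. -/
noncomputable def edgeKernel (lam : ℝ) (r : ℕ) (x : ℝ) (u : ℂ) : ℂ :=
  u ^ r / (r.factorial : ℂ) * (1 + u * (x / jb x ^ 2 : ℝ)) / ((lam - x : ℝ) - u)

theorem stripHeight_re (ε x : ℝ) : (stripHeight ε x).re = 0 := by simp [stripHeight]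

theorem stripHeight_im (ε x : ℝ) : (stripHeight ε x).im = ε * jb x := by simp [stripHeight]

theorem ofReal_sub_stripHeight_ne_zero {ε : ℝ} (hε : ε ≠ 0) (c x : ℝ) :
    (c : ℂ) - stripHeight ε x ≠ 0 :=
  ofReal_sub_ne_zero (by rw [stripHeight_im]; exact mul_ne_zero hε (jb_ne_zero x)) c

theorem neg_stripHeight (ε x : ℝ) : -stripHeight ε x = stripHeight (-ε) x := by
  simp [stripHeight]

theorem hasDerivAt_stripHeight (ε x : ℝ) :
    HasDerivAt (stripHeight ε) (stripHeight ε x * (x / jb x ^ 2 : ℝ)) x := by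
  have h := ((hasDerivAt_jb x).const_mul ε).ofReal_comp.const_mul Complex.I
  refine h.congr_deriv ?_
  rw [stripHeight, mul_assoc, ← Complex.ofReal_mul]
  congr 2
  have := jb_ne_zero x
  field_simp

theorem mul_edgeKernel {lam x : ℝ} {u : ℂ} (hu : ((lam - x : ℝ) : ℂ) - u ≠ 0) (r : ℕ) :
    ((lam - x : ℝ) : ℂ) * edgeKernel lam r x u = ((r + 1 : ℕ) : ℂ) * edgeKernel lam (r + 1) x u +
      u ^ r / (r.factorial : ℂ) * (1 + u * (x / jb x ^ 2 : ℝ)) := by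
  have hr : (r.factorial : ℂ) ≠ 0 := by exact_mod_cast r.factorial_ne_zero
  have hr1 : ((r + 1 : ℕ) : ℂ) ≠ 0 := by exact_mod_cast r.succ_ne_zero
  rw [edgeKernel, edgeKernel, Nat.factorial_succ, Nat.cast_mul, pow_succ]
  generalize ((x / jb x ^ 2 : ℝ) : ℂ) = y
  generalize ((lam - x : ℝ) : ℂ) = c at *
  field_simp
  ring

theorem hasDerivAt_cauchyKernel_zero {ε : ℝ} (hε : ε ≠ 0) {lam x : ℝ} (hx : x ≠ lam) :
    HasDerivAt (cauchyKernel ε lam 0)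
      (edgeKernel lam 0 x (stripHeight ε x) - edgeKernel lam 0 x (-stripHeight ε x)) x := by
  have hc : lam - x ≠ 0 := sub_ne_zero.mpr hx.symm
  have h1 : HasDerivAt (fun y : ℝ => lam - y) (-1) x := by
    simpa using (hasDerivAt_id x).const_sub lam
  have h2 := ((((hasDerivAt_jb x).const_mul ε).div h1 hc).arctan.ofReal_comp).const_mul
    (2 * Complex.I)
  refine h2.congr_deriv ?_
  have hn := ofReal_sub_stripHeight_ne_zero hε (lam - x) x
  have hn' := ofReal_sub_stripHeight_ne_zero (neg_ne_zero.mpr hε) (lam - x) x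
  rw [← neg_stripHeight] at hn'
  have hb : (jb x : ℂ) ≠ 0 := by exact_mod_cast jb_ne_zero x
  have hD : (((lam - x) ^ 2 + (ε * jb x) ^ 2 : ℝ) : ℂ) =
      (((lam - x : ℝ) : ℂ) - stripHeight ε x) * (((lam - x : ℝ) : ℂ) - -stripHeight ε x) := by
    rw [stripHeight]
    push_cast
    linear_combination (ε * jb x : ℂ) ^ 2 * Complex.I_sq
  have hD0 : (lam - x) ^ 2 + (ε * jb x) ^ 2 ≠ 0 := by
    have := sq_pos_of_ne_zero hc
    positivity
  have e1 : 1 / (1 + (ε * jb x / (lam - x)) ^ 2) *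
      ((ε * (x / jb x) * (lam - x) - ε * jb x * -1) / (lam - x) ^ 2) =
      (ε * (x / jb x) * (lam - x) + ε * jb x) / ((lam - x) ^ 2 + (ε * jb x) ^ 2) := by
    have h3 : 1 + (ε * jb x / (lam - x)) ^ 2 ≠ 0 := by positivity
    rw [div_mul_div_comm, div_eq_div_iff (mul_ne_zero h3 (pow_ne_zero 2 hc)) hD0]
    have h4 : (1 + (ε * jb x / (lam - x)) ^ 2) * (lam - x) ^ 2 =
        (lam - x) ^ 2 + (ε * jb x) ^ 2 := by
      field_simp
    rw [h4]
    ring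
  change 2 * Complex.I * ((1 / (1 + (ε * jb x / (lam - x)) ^ 2) *
    ((ε * (x / jb x) * (lam - x) - ε * jb x * -1) / (lam - x) ^ 2) : ℝ) : ℂ) = _
  rw [e1, Complex.ofReal_div, hD, edgeKernel, edgeKernel, div_sub_div _ _ hn hn', mul_div_assoc']
  congr 1
  rw [stripHeight]
  push_cast
  field_simp
  ring

theorem hasDerivAt_cauchyKernel_succ {ε : ℝ} (hε : ε ≠ 0) {lam x : ℝ} (hx : x ≠ lam) (r : ℕ) :
    HasDerivAt (cauchyKernel ε lam (r + 1))
      (edgeKernel lam (r + 1) x (stripHeight ε x) - edgeKernel lam (r + 1) x (-stripHeight ε x) -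
        cauchyKernel ε lam r x) x := by
  have h1 : HasDerivAt (fun y : ℝ => ((lam - y : ℝ) : ℂ)) (-1) x := by
    simpa using ((hasDerivAt_id x).const_sub lam).ofReal_comp
  have hn := ofReal_sub_stripHeight_ne_zero hε (lam - x) x
  have hn' := ofReal_sub_stripHeight_ne_zero (neg_ne_zero.mpr hε) (lam - x) x
  rw [← neg_stripHeight] at hn'
  have hS := hasDerivAt_stripHeight ε x
  have hE : ∀ r : ℕ, HasDerivAt (fun y => (stripHeight ε y ^ (r + 1) -
      (-stripHeight ε y) ^ (r + 1)) / ((r + 1).factorial : ℂ))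
      ((x / jb x ^ 2 : ℝ) * (stripHeight ε x ^ (r + 1) - (-stripHeight ε x) ^ (r + 1)) /
        (r.factorial : ℂ)) x := by
    intro r
    have hr : (r.factorial : ℂ) ≠ 0 := by exact_mod_cast r.factorial_ne_zero
    have hr1 : ((r + 1 : ℕ) : ℂ) ≠ 0 := by exact_mod_cast r.succ_ne_zero
    refine (((hS.pow (r + 1)).sub (hS.neg.pow (r + 1))).div_const _).congr_deriv ?_
    rw [Nat.factorial_succ, Nat.cast_mul, Nat.add_sub_cancel]
    simp only [Pi.neg_apply]
    field_simp
    ring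
  induction r with
  | zero =>
    refine (((h1.mul (hasDerivAt_cauchyKernel_zero hε hx)).sub (hE 0)).div_const _).congr_deriv ?_
    have e1 := mul_edgeKernel hn 0
    have e2 := mul_edgeKernel hn' 0
    simp only [Nat.factorial_zero, Nat.cast_one, pow_zero, zero_add, pow_one, div_one,
      one_mul] at e1 e2 ⊢
    linear_combination e1 - e2
  | succ r ih =>
    refine (((h1.mul ih).sub (hE (r + 1))).div_const _).congr_deriv ?_
    have e1 := mul_edgeKernel hn (r + 1)
    have e2 := mul_edgeKernel hn' (r + 1)
    have e3 : cauchyKernel ε lam (r + 1) x = (((lam - x : ℝ) : ℂ) * cauchyKernel ε lam r x -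
      (stripHeight ε x ^ (r + 1) - (-stripHeight ε x) ^ (r + 1)) / ((r + 1).factorial : ℂ)) /
        ((r + 1 : ℕ) : ℂ) := rfl
    have hr1 : ((r + 1 : ℕ) : ℂ) ≠ 0 := by exact_mod_cast r.succ_ne_zero
    have hr2 : ((r + 1 + 1 : ℕ) : ℂ) ≠ 0 := by exact_mod_cast (r + 1).succ_ne_zero
    rw [eq_div_iff hr1] at e3
    rw [div_eq_iff hr2]
    have e4 : ((r + 1 + 1 : ℕ) : ℂ) = ((r + 1 : ℕ) : ℂ) + 1 := by push_cast; ring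
    rw [e4] at e1 e2 ⊢
    linear_combination e1 - e2 + e3

theorem measurable_cauchyKernel (ε lam : ℝ) (r : ℕ) : Measurable (cauchyKernel ε lam r) := by
  have hj : Measurable jb := continuous_jb.measurable
  induction r with
  | zero =>
    change Measurable fun x =>
      2 * Complex.I * (Real.arctan (ε * jb x / (lam - x)) : ℂ)
    have h1 : Measurable fun x => ε * jb x / (lam - x) := by fun_prop
    exact (Complex.measurable_ofReal.comp (Real.measurable_arctan.comp h1)).const_mul _
  | succ r ih =>
    have h1 : Measurable (stripHeight ε) := by
      unfold stripHeight
      fun_prop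
    change Measurable fun x => (((lam - x : ℝ) : ℂ) * cauchyKernel ε lam r x -
      (stripHeight ε x ^ (r + 1) - (-stripHeight ε x) ^ (r + 1)) / ((r + 1).factorial : ℂ)) /
        ((r + 1 : ℕ) : ℂ)
    fun_prop

theorem measurable_edgeKernel (lam : ℝ) (r : ℕ) (ε : ℝ) :
    Measurable fun x => edgeKernel lam r x (stripHeight ε x) := by
  have hj : Measurable jb := continuous_jb.measurable
  unfold edgeKernel stripHeight
  fun_prop

/-! ### Integration by parts across a jump -/

theorem tendsto_zero_atTop_of_integrable_div_jb {ψ ψ' : ℝ → ℂ} {a : ℝ}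
    (hd : ∀ x ∈ Set.Ioi a, HasDerivAt ψ (ψ' x) x) (hψ' : IntegrableOn ψ' (Set.Ioi a))
    (hψ : IntegrableOn (fun x => ψ x / (jb x : ℂ)) (Set.Ioi a)) :
    Tendsto ψ atTop (𝓝 0) := by
  have h1 := tendsto_limUnder_of_hasDerivAt_of_integrableOn_Ioi hd hψ'
  set L := limUnder atTop ψ
  by_cases hL : L = 0
  · rwa [hL] at h1
  exfalso
  have hL' : 0 < ‖L‖ := norm_pos_iff.mpr hL
  have h2 : ∀ᶠ x in atTop, ‖L‖ / 2 < ‖ψ x‖ := h1.norm.eventually (lt_mem_nhds (half_lt_self hL'))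
  obtain ⟨R, hR⟩ := (h2.and (eventually_ge_atTop (max a 1))).exists_forall_of_atTop
  have hRa : a ≤ R := (le_max_left _ _).trans (hR R le_rfl).2
  refine not_integrableOn_Ioi_inv (a := R) ?_
  refine Integrable.mono' (((hψ.mono_set (Set.Ioi_subset_Ioi hRa)).norm).const_mul (4 / ‖L‖))
    measurable_inv.aestronglyMeasurable ?_
  filter_upwards [ae_restrict_mem measurableSet_Ioi] with x hx
  obtain ⟨h3, h4⟩ := hR x (le_of_lt hx)
  have hx1 : 1 ≤ x := (le_max_right _ _).trans h4
  have h5 : jb x ≤ 2 * x := by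
    rw [jb, Real.sqrt_le_left (by linarith)]
    nlinarith
  rw [norm_div, Complex.norm_real, Real.norm_of_nonneg (jb_pos x).le,
    Real.norm_of_nonneg (inv_nonneg.mpr (by linarith)), div_mul_div_comm, inv_eq_one_div,
    div_le_div_iff₀ (by linarith) (mul_pos hL' (jb_pos x))]
  nlinarith [mul_le_mul_of_nonneg_left h5 hL'.le]

theorem tendsto_zero_atBot_of_integrable_div_jb {ψ ψ' : ℝ → ℂ} {a : ℝ}
    (hd : ∀ x ∈ Set.Iio a, HasDerivAt ψ (ψ' x) x) (hψ' : Integrable ψ')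
    (hψ : Integrable (fun x => ψ x / (jb x : ℂ))) :
    Tendsto ψ atBot (𝓝 0) := by
  have h1 : Tendsto (fun x => ψ (-x)) atTop (𝓝 0) := by
    refine tendsto_zero_atTop_of_integrable_div_jb (ψ' := fun x => -ψ' (-x)) (a := -a)
      (fun x hx => ?_) hψ'.comp_neg.neg.integrableOn ?_
    · have h2 := (hd (-x) (by simpa [neg_lt] using hx)).scomp x (hasDerivAt_neg x)
      simpa [Function.comp_def] using h2
    · have h2 := hψ.comp_neg.integrableOn (s := Set.Ioi (-a))
      simpa [jb] using h2
  simpa [Function.comp_def] using h1.comp tendsto_neg_atBot_atTop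

theorem integral_mul_deriv_of_jump {u u' v v' : ℝ → ℂ} {a : ℝ} {ℓ ℓ' : ℂ}
    (hu : ∀ x, HasDerivAt u (u' x) x) (hv : ∀ x, x ≠ a → HasDerivAt v (v' x) x)
    (huv' : Integrable (u * v')) (hu'v : Integrable (u' * v))
    (huv : Integrable fun x => (u * v) x / (jb x : ℂ))
    (hl : Tendsto v (𝓝[<] a) (𝓝 ℓ)) (hr : Tendsto v (𝓝[>] a) (𝓝 ℓ')) :
    ∫ x, u x * v' x = u a * (ℓ - ℓ') - ∫ x, u' x * v x := by
  have hd : ∀ x, x ≠ a → HasDerivAt (u * v) ((u' * v + u * v') x) x := fun x hx =>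
    (hu x).mul (hv x hx)
  have hua : Tendsto u (𝓝 a) (𝓝 (u a)) := (hu a).continuousAt
  have hint := hu'v.add huv'
  have h1 := integral_Ioi_mul_deriv_eq_deriv_mul (fun x _ => hu x)
    (fun x (hx : a < x) => hv x hx.ne') huv'.integrableOn hu'v.integrableOn
    ((hua.mono_left nhdsWithin_le_nhds).mul hr)
    (tendsto_zero_atTop_of_integrable_div_jb (fun x (hx : a < x) => hd x hx.ne')
      hint.integrableOn huv.integrableOn)
  have h2 := integral_Iic_mul_deriv_eq_deriv_mul (fun x _ => hu x)
    (fun x (hx : x < a) => hv x hx.ne) huv'.integrableOn hu'v.integrableOn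
    ((hua.mono_left nhdsWithin_le_nhds).mul hl)
    (tendsto_zero_atBot_of_integrable_div_jb (fun x (hx : x < a) => hd x hx.ne) hint huv)
  have h3 := integral_add_compl (measurableSet_Iic (a := a)) huv'
  have h4 := integral_add_compl (measurableSet_Iic (a := a)) hu'v
  rw [Set.compl_Iic] at h3 h4
  simp only [Pi.mul_apply] at h3 h4
  rw [← h3, ← h4, h1, h2]
  ring

/-! ### Bounds and limits of the kernels -/

/-- The integrand whose integral over `[-ε, ε]` is the kernel `cauchyKernel ε lam r x`. -/
noncomputable def segmentKernel (lam : ℝ) (r : ℕ) (x τ : ℝ) : ℂ :=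
  stripHeight τ x ^ r / (r.factorial : ℂ) * (Complex.I * (jb x : ℂ)) /
    (((lam - x : ℝ) : ℂ) - stripHeight τ x)

theorem ofReal_sub_stripHeight_ne_zero' {c : ℝ} (hc : c ≠ 0) (ε x : ℝ) :
    (c : ℂ) - stripHeight ε x ≠ 0 := by
  intro h
  apply hc
  have := congrArg Complex.re h
  simpa [stripHeight] using this

theorem continuous_stripHeight (x : ℝ) : Continuous fun τ => stripHeight τ x := by
  unfold stripHeight
  fun_prop

theorem continuous_segmentKernel {lam x : ℝ} (hx : x ≠ lam) (r : ℕ) :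
    Continuous (segmentKernel lam r x) := by
  have h := continuous_stripHeight x
  unfold segmentKernel
  exact Continuous.div (by fun_prop) (by fun_prop)
    fun τ => ofReal_sub_stripHeight_ne_zero' (sub_ne_zero.mpr hx.symm) τ x

theorem cauchyKernel_eq_integral {lam x : ℝ} (hx : x ≠ lam) (ε : ℝ) (r : ℕ) :
    cauchyKernel ε lam r x = ∫ τ in (-ε)..ε, segmentKernel lam r x τ := by
  have hc : lam - x ≠ 0 := sub_ne_zero.mpr hx.symm
  have hcc : ((lam - x : ℝ) : ℂ) ≠ 0 := by exact_mod_cast hc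
  induction r with
  | zero =>
    have hD : ∀ τ : ℝ, HasDerivAt (fun τ : ℝ => Complex.I * (Real.arctan (τ * jb x / (lam - x)) : ℂ)
        - ((Real.log ((lam - x) ^ 2 + (τ * jb x) ^ 2) / 2 : ℝ) : ℂ)) (segmentKernel lam 0 x τ) τ := by
      intro τ
      have hD0 : (lam - x) ^ 2 + (τ * jb x) ^ 2 ≠ 0 := by
        have := sq_pos_of_ne_zero hc
        positivity
      have h0 : HasDerivAt (fun τ : ℝ => τ * jb x) (jb x) τ := by
        simpa using (hasDerivAt_id τ).mul_const (jb x)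
      have h1 := ((h0.div_const (lam - x)).arctan.ofReal_comp).const_mul Complex.I
      have h2 := ((((h0.pow 2).const_add ((lam - x) ^ 2)).log hD0).div_const 2).ofReal_comp
      refine (h1.sub h2).congr_deriv ?_
      have hn := ofReal_sub_stripHeight_ne_zero' hc τ x
      have e0 : (((lam - x) ^ 2 + (τ * jb x) ^ 2 : ℝ) : ℂ) =
          (((lam - x : ℝ) : ℂ) - stripHeight τ x) * (((lam - x : ℝ) : ℂ) + stripHeight τ x) := by
        rw [stripHeight]
        push_cast
        linear_combination (τ * jb x : ℂ) ^ 2 * Complex.I_sq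
      have hD1 : (((lam - x) ^ 2 + (τ * jb x) ^ 2 : ℝ) : ℂ) ≠ 0 := by exact_mod_cast hD0
      have e1 : 1 / (1 + (τ * jb x / (lam - x)) ^ 2) * (jb x / (lam - x)) =
          jb x * (lam - x) / ((lam - x) ^ 2 + (τ * jb x) ^ 2) := by
        have h3 : 1 + (τ * jb x / (lam - x)) ^ 2 ≠ 0 := by positivity
        rw [div_mul_div_comm, div_eq_div_iff (mul_ne_zero h3 hc) hD0]
        field_simp
      have hn2 : ((lam - x : ℝ) : ℂ) + stripHeight τ x ≠ 0 := by
        intro h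
        rw [h, mul_zero] at e0
        exact hD1 e0
      change Complex.I * ((1 / (1 + (τ * jb x / (lam - x)) ^ 2) * (jb x / (lam - x)) : ℝ) : ℂ) -
        (((2 : ℕ) * (τ * jb x) ^ (2 - 1) * jb x / ((lam - x) ^ 2 + (τ * jb x) ^ 2) / 2 : ℝ) : ℂ) = _
      have e2 : (((2 : ℕ) * (τ * jb x) ^ (2 - 1) * jb x / ((lam - x) ^ 2 + (τ * jb x) ^ 2) / 2 : ℝ) :
          ℂ) = (τ * jb x * jb x : ℂ) / (((lam - x) ^ 2 + (τ * jb x) ^ 2 : ℝ) : ℂ) := by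
        push_cast
        ring
      rw [e1, e2, segmentKernel, Complex.ofReal_div, e0, pow_zero, Nat.factorial_zero, Nat.cast_one,
        div_one, one_mul, ← mul_div_assoc, ← sub_div,
        div_eq_div_iff (mul_ne_zero hn hn2) hn, stripHeight]
      push_cast
      linear_combination (-(((lam : ℂ) - x - Complex.I * (τ * jb x)) * (τ * jb x * jb x))) *
        Complex.I_sq
    rw [intervalIntegral.integral_eq_sub_of_hasDerivAt (fun τ _ => hD τ)
      ((continuous_segmentKernel hx 0).intervalIntegrable _ _)]
    change 2 * Complex.I * (Real.arctan (ε * jb x / (lam - x)) : ℂ) = _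
    rw [neg_mul, neg_div, Real.arctan_neg, neg_sq]
    push_cast
    ring
  | succ r ih =>
    have hr : (r.factorial : ℂ) ≠ 0 := by exact_mod_cast r.factorial_ne_zero
    have hr1 : ((r + 1 : ℕ) : ℂ) ≠ 0 := by exact_mod_cast r.succ_ne_zero
    have h0 : ∀ τ : ℝ, HasDerivAt (fun τ => stripHeight τ x ^ (r + 1) / ((r + 1).factorial : ℂ))
        (stripHeight τ x ^ r / (r.factorial : ℂ) * (Complex.I * (jb x : ℂ))) τ := by
      intro τ
      have h1 : HasDerivAt (fun τ : ℝ => stripHeight τ x) (Complex.I * (jb x : ℂ)) τ := by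
        have h2 := (((hasDerivAt_id τ).mul_const (jb x)).ofReal_comp).const_mul Complex.I
        simpa [stripHeight] using h2
      refine ((h1.pow (r + 1)).div_const _).congr_deriv ?_
      rw [Nat.factorial_succ, Nat.cast_mul, Nat.add_sub_cancel]
      field_simp
    have h1 : ∀ τ, segmentKernel lam (r + 1) x τ =
        (((lam - x : ℝ) : ℂ) * segmentKernel lam r x τ -
          stripHeight τ x ^ r / (r.factorial : ℂ) * (Complex.I * (jb x : ℂ))) /
            ((r + 1 : ℕ) : ℂ) := by
      intro τ
      have hn := ofReal_sub_stripHeight_ne_zero' hc τ x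
      rw [segmentKernel, segmentKernel, Nat.factorial_succ, Nat.cast_mul]
      generalize ((lam - x : ℝ) : ℂ) = c at *
      field_simp
      ring
    have hcont : Continuous fun τ => stripHeight τ x ^ r / (r.factorial : ℂ) *
        (Complex.I * (jb x : ℂ)) := by
      have h := continuous_stripHeight x
      fun_prop
    simp only [h1]
    rw [intervalIntegral.integral_div, intervalIntegral.integral_sub
      (((continuous_segmentKernel hx r).intervalIntegrable _ _).const_mul _)
      (hcont.intervalIntegrable _ _), intervalIntegral.integral_const_mul, ← ih,
      intervalIntegral.integral_eq_sub_of_hasDerivAt (fun τ _ => h0 τ)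
        (hcont.intervalIntegrable _ _), ← neg_stripHeight, ← sub_div]
    rfl

theorem norm_stripHeight (ε x : ℝ) : ‖stripHeight ε x‖ = |ε| * jb x := by
  rw [stripHeight, norm_mul, Complex.norm_I, one_mul, Complex.norm_real, Real.norm_eq_abs, abs_mul,
    abs_of_pos (jb_pos x)]

theorem le_norm_ofReal_sub_stripHeight (c ε x : ℝ) : |ε| * jb x ≤ ‖(c : ℂ) - stripHeight ε x‖ := by
  have h := abs_im_le_norm_ofReal_sub (stripHeight ε x) c
  rwa [stripHeight_im, abs_mul, abs_of_pos (jb_pos x)] at h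

theorem norm_div_factorial_le (u : ℂ) (r : ℕ) : ‖u / (r.factorial : ℂ)‖ ≤ ‖u‖ := by
  rw [norm_div, Complex.norm_natCast]
  exact div_le_self (norm_nonneg _) (by exact_mod_cast r.factorial_pos)

theorem norm_segmentKernel_succ_le {lam x τ : ℝ} (hτ : |τ| ≤ 1) (r : ℕ) :
    ‖segmentKernel lam (r + 1) x τ‖ ≤ jb x ^ (r + 1) := by
  have hb := jb_pos x
  rcases eq_or_ne τ 0 with rfl | h0
  · have : stripHeight 0 x = 0 := by simp [stripHeight]
    simp only [segmentKernel, this]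
    simp
    positivity
  have hτ0 : 0 < |τ| := abs_pos.mpr h0
  have h1 := le_norm_ofReal_sub_stripHeight (lam - x) τ x
  have h2 : 0 < |τ| * jb x := by positivity
  rw [segmentKernel, norm_div, div_le_iff₀ (h2.trans_le h1), norm_mul, norm_mul, Complex.norm_I,
    one_mul, Complex.norm_real, Real.norm_of_nonneg hb.le]
  calc _ ≤ (|τ| * jb x) ^ (r + 1) * jb x := by
        gcongr
        refine (norm_div_factorial_le _ _).trans ?_
        rw [norm_pow, norm_stripHeight]
    _ = |τ| ^ r * (jb x ^ (r + 1) * (|τ| * jb x)) := by ring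
    _ ≤ 1 * (jb x ^ (r + 1) * ‖((lam - x : ℝ) : ℂ) - stripHeight τ x‖) := by
        gcongr
        exact pow_le_one₀ hτ0.le hτ
    _ = _ := one_mul _

theorem norm_cauchyKernel_succ_le {ε lam x : ℝ} (hε0 : 0 < ε) (hε1 : ε ≤ 1) (hx : x ≠ lam) (r : ℕ) :
    ‖cauchyKernel ε lam (r + 1) x‖ ≤ 2 * ε * jb x ^ (r + 1) := by
  rw [cauchyKernel_eq_integral hx]
  have h := intervalIntegral.norm_integral_le_of_norm_le_const (a := -ε) (b := ε)
    (f := segmentKernel lam (r + 1) x) (C := jb x ^ (r + 1)) fun τ hτ => by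
      rw [Set.uIoc_of_le (by linarith)] at hτ
      exact norm_segmentKernel_succ_le (abs_le.mpr ⟨by linarith [hτ.1], by linarith [hτ.2]⟩) r
  refine h.trans (le_of_eq ?_)
  rw [abs_of_nonneg (by linarith)]
  ring

theorem norm_cauchyKernel_le {ε lam x : ℝ} (hε0 : 0 < ε) (hε1 : ε ≤ 1) (hx : x ≠ lam) (r : ℕ) :
    ‖cauchyKernel ε lam r x‖ ≤ 4 * jb x ^ r := by
  cases r with
  | zero =>
    change ‖2 * Complex.I * (Real.arctan (ε * jb x / (lam - x)) : ℂ)‖ ≤ _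
    rw [norm_mul, norm_mul, Complex.norm_I, Complex.norm_real, Real.norm_eq_abs, Complex.norm_two]
    have h1 := Real.arctan_lt_pi_div_two (ε * jb x / (lam - x))
    have h2 := Real.neg_pi_div_two_lt_arctan (ε * jb x / (lam - x))
    have h3 := Real.pi_le_four
    have h4 : |Real.arctan (ε * jb x / (lam - x))| ≤ 2 := abs_le.mpr ⟨by linarith, by linarith⟩
    rw [pow_zero]
    linarith
  | succ r =>
    refine (norm_cauchyKernel_succ_le hε0 hε1 hx r).trans ?_
    have := jb_pos x
    gcongr
    linarith

theorem norm_edgeKernel_le {ε : ℝ} (hε0 : ε ≠ 0) (hε1 : |ε| ≤ 1) (lam x : ℝ) (r : ℕ) :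
    ‖edgeKernel lam r x (stripHeight ε x)‖ ≤ 2 / |ε| * (jb x ^ r / jb x) := by
  have hb := jb_pos x
  have hε : 0 < |ε| := abs_pos.mpr hε0
  have h1 := le_norm_ofReal_sub_stripHeight (lam - x) ε x
  have h2 : ‖1 + stripHeight ε x * (x / jb x ^ 2 : ℝ)‖ ≤ 2 := by
    refine (norm_add_le _ _).trans ?_
    rw [norm_mul, norm_stripHeight, Complex.norm_real, Real.norm_eq_abs, abs_div,
      abs_of_pos (pow_pos hb 2), norm_one]
    have h3 : |ε| * jb x * (|x| / jb x ^ 2) = |ε| * (|x| / jb x) := by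
      field_simp
    have h4 : |x| / jb x ≤ 1 := (div_le_one hb).mpr (abs_le_jb x)
    have h5 : 0 ≤ |x| / jb x := by positivity
    rw [h3]
    nlinarith
  rw [edgeKernel, norm_div, norm_mul]
  calc _ ≤ (1 * jb x) ^ r * 2 / (|ε| * jb x) := by
        gcongr
        refine (norm_div_factorial_le _ _).trans ?_
        rw [norm_pow, norm_stripHeight]
        gcongr
    _ = _ := by
        rw [one_mul]
        field_simp

theorem tendsto_cauchyKernel_succ {ε lam : ℝ} {l : Filter ℝ} (hl : l ≤ 𝓝 lam) {ℓ : ℂ} {r : ℕ}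
    (h : Tendsto (cauchyKernel ε lam r) l (𝓝 ℓ)) :
    Tendsto (cauchyKernel ε lam (r + 1)) l (𝓝 (cauchyKernel ε lam (r + 1) lam)) := by
  have hS : Tendsto (stripHeight ε) l (𝓝 (stripHeight ε lam)) :=
    ((hasDerivAt_stripHeight ε lam).continuousAt).mono_left hl
  have hc : Tendsto (fun x : ℝ => ((lam - x : ℝ) : ℂ)) l (𝓝 ((lam - lam : ℝ) : ℂ)) := by
    have : Continuous fun x : ℝ => ((lam - x : ℝ) : ℂ) := by fun_prop
    exact (this.tendsto lam).mono_left hl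
  have h1 := ((hc.mul h).sub (((hS.pow (r + 1)).sub (hS.neg.pow (r + 1))).div_const
    ((r + 1).factorial : ℂ))).div_const ((r + 1 : ℕ) : ℂ)
  convert h1 using 2
  · rfl
  · rw [cauchyKernel, sub_self]
    simp

theorem tendsto_cauchyKernel_zero_left {ε : ℝ} (hε : 0 < ε) (lam : ℝ) :
    Tendsto (cauchyKernel ε lam 0) (𝓝[<] lam) (𝓝 (Real.pi * Complex.I)) := by
  have h1 : Tendsto (fun x => lam - x) (𝓝[<] lam) (𝓝[>] 0) := by
    refine tendsto_nhdsWithin_iff.mpr ⟨?_, ?_⟩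
    · have : Continuous fun x => lam - x := by fun_prop
      simpa using (this.tendsto lam).mono_left nhdsWithin_le_nhds
    · filter_upwards [self_mem_nhdsWithin] with x hx
      exact sub_pos.mpr (show x < lam from hx)
  have h2 : Tendsto (fun x => ε * jb x) (𝓝[<] lam) (𝓝 (ε * jb lam)) :=
    ((continuous_const.mul continuous_jb).tendsto lam).mono_left nhdsWithin_le_nhds
  have h3 := h2.pos_mul_atTop (mul_pos hε (jb_pos lam)) (tendsto_inv_nhdsGT_zero.comp h1)
  have h4 := (Real.tendsto_arctan_atTop.mono_right nhdsWithin_le_nhds).comp h3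
  have h5 := ((Complex.continuous_ofReal.tendsto _).comp h4).const_mul (2 * Complex.I)
  convert h5 using 2 with x
  · change _ = 2 * Complex.I * ((Real.arctan (ε * jb x * (lam - x)⁻¹) : ℝ) : ℂ)
    rw [← div_eq_mul_inv]
    rfl
  · push_cast
    ring

theorem tendsto_cauchyKernel_zero_right {ε : ℝ} (hε : 0 < ε) (lam : ℝ) :
    Tendsto (cauchyKernel ε lam 0) (𝓝[>] lam) (𝓝 (-(Real.pi * Complex.I))) := by
  have h1 : Tendsto (fun x => lam - x) (𝓝[>] lam) (𝓝[<] 0) := by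
    refine tendsto_nhdsWithin_iff.mpr ⟨?_, ?_⟩
    · have : Continuous fun x => lam - x := by fun_prop
      simpa using (this.tendsto lam).mono_left nhdsWithin_le_nhds
    · filter_upwards [self_mem_nhdsWithin] with x hx
      exact sub_neg.mpr (show lam < x from hx)
  have h2 : Tendsto (fun x => ε * jb x) (𝓝[>] lam) (𝓝 (ε * jb lam)) :=
    ((continuous_const.mul continuous_jb).tendsto lam).mono_left nhdsWithin_le_nhds
  have h3 := h2.pos_mul_atBot (mul_pos hε (jb_pos lam)) (tendsto_inv_nhdsLT_zero.comp h1)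
  have h4 := (Real.tendsto_arctan_atBot.mono_right nhdsWithin_le_nhds).comp h3
  have h5 := ((Complex.continuous_ofReal.tendsto _).comp h4).const_mul (2 * Complex.I)
  convert h5 using 2 with x
  · change _ = 2 * Complex.I * ((Real.arctan (ε * jb x * (lam - x)⁻¹) : ℝ) : ℂ)
    rw [← div_eq_mul_inv]
    rfl
  · push_cast
    ring

/-! ### The Cauchy-type formula for functions in `T^a` -/

theorem hasDerivAt_iteratedDeriv {f : ℝ → ℂ} (hf : ContDiff ℝ (⊤ : ℕ∞) f) (r : ℕ) (x : ℝ) :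
    HasDerivAt (iteratedDeriv r f) (iteratedDeriv (r + 1) f x) x := by
  rw [iteratedDeriv_succ]
  refine DifferentiableAt.hasDerivAt ?_
  exact (hf.differentiable_iteratedDeriv r (by exact_mod_cast WithTop.coe_lt_top _)) x

theorem tWeight_nonneg (β : ℝ) (k : ℕ) (f : ℝ → ℂ) (x : ℝ) : 0 ≤ tWeight β k f x :=
  mul_nonneg (norm_nonneg _) (Real.rpow_nonneg (jb_pos x).le _)

theorem TNorm_nonneg (β : ℝ) (k : ℕ) (f : ℝ → ℂ) : 0 ≤ TNorm β k f :=
  integral_nonneg (tWeight_nonneg β k f)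

theorem continuous_iteratedDeriv_of_contDiff {f : ℝ → ℂ} (hf : ContDiff ℝ (⊤ : ℕ∞) f) (r : ℕ) :
    Continuous (iteratedDeriv r f) :=
  continuous_iff_continuousAt.mpr fun x => (hasDerivAt_iteratedDeriv hf r x).continuousAt

theorem norm_iteratedDeriv_mul_le_tWeight {a : ℝ} (ha : a ≤ 0) (g : ℝ → ℂ) (r : ℕ) (x : ℝ) :
    ‖iteratedDeriv r g x‖ * (jb x ^ r / jb x) ≤ tWeight a r g x := by
  rw [tWeight]
  gcongr
  rw [← Real.rpow_natCast, ← Real.rpow_sub_one (jb_ne_zero x)]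
  exact Real.rpow_le_rpow_of_exponent_le (one_le_jb x) (by linarith)

theorem norm_iteratedDeriv_mul_le {a : ℝ} (ha : a ≤ 0) (g : ℝ → ℂ) {r : ℕ} {c x : ℝ} {y : ℂ}
    (hc : 0 ≤ c) (hy : ‖y‖ ≤ c * (jb x ^ r / jb x)) :
    ‖iteratedDeriv r g x * y‖ ≤ c * tWeight a r g x := by
  rw [norm_mul]
  calc _ ≤ ‖iteratedDeriv r g x‖ * (c * (jb x ^ r / jb x)) := by gcongr
    _ = c * (‖iteratedDeriv r g x‖ * (jb x ^ r / jb x)) := by ring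
    _ ≤ _ := by
      gcongr
      exact norm_iteratedDeriv_mul_le_tWeight ha g r x

theorem MemT.integrable_iteratedDeriv_mul {a : ℝ} (ha : a ≤ 0) {g : ℝ → ℂ} (hg : MemT a g) {r : ℕ}
    {c : ℝ} (hc : 0 ≤ c) {k : ℝ → ℂ} (hk : Measurable k)
    (hkc : ∀ᵐ x, ‖k x‖ ≤ c * (jb x ^ r / jb x)) :
    Integrable fun x => iteratedDeriv r g x * k x := by
  refine Integrable.mono' ((hg.2 r).const_mul c)
    ((continuous_iteratedDeriv_of_contDiff hg.1 r).measurable.mul hk).aestronglyMeasurable ?_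
  filter_upwards [hkc] with x hx
  exact norm_iteratedDeriv_mul_le ha g hc hx

theorem MemT.norm_integral_iteratedDeriv_mul_le {a : ℝ} (ha : a ≤ 0) {g : ℝ → ℂ} (hg : MemT a g)
    {r : ℕ} {c : ℝ} (hc : 0 ≤ c) {k : ℝ → ℂ} (hkc : ∀ᵐ x, ‖k x‖ ≤ c * (jb x ^ r / jb x)) :
    ‖∫ x, iteratedDeriv r g x * k x‖ ≤ c * TNorm a r g := by
  rw [TNorm, ← integral_const_mul]
  refine norm_integral_le_of_norm_le ((hg.2 r).const_mul c) ?_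
  filter_upwards [hkc] with x hx
  exact norm_iteratedDeriv_mul_le ha g hc hx

/-- The difference of the contributions of the two ends of the segment. -/
noncomputable def edgePair (ε lam : ℝ) (r : ℕ) (x : ℝ) : ℂ :=
  edgeKernel lam r x (stripHeight ε x) - edgeKernel lam r x (-stripHeight ε x)

theorem measurable_edgePair (ε lam : ℝ) (r : ℕ) : Measurable (edgePair ε lam r) := by
  unfold edgePair
  simp only [neg_stripHeight]
  exact (measurable_edgeKernel lam r ε).sub (measurable_edgeKernel lam r (-ε))

theorem norm_edgePair_le {ε : ℝ} (hε0 : 0 < ε) (hε1 : ε ≤ 1) (lam x : ℝ) (r : ℕ) :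
    ‖edgePair ε lam r x‖ ≤ 4 / ε * (jb x ^ r / jb x) := by
  have h1 := norm_edgeKernel_le hε0.ne' (by rwa [abs_of_pos hε0]) lam x r
  have h2 := norm_edgeKernel_le (neg_ne_zero.mpr hε0.ne') (by rwa [abs_neg, abs_of_pos hε0]) lam x r
  rw [abs_neg] at h2
  rw [abs_of_pos hε0] at h1 h2
  rw [edgePair, neg_stripHeight]
  refine (norm_sub_le _ _).trans ((add_le_add h1 h2).trans (le_of_eq ?_))
  ring

theorem ae_ne_real (lam : ℝ) : ∀ᵐ x : ℝ, x ≠ lam := by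
  simp [ae_iff]

theorem ae_norm_cauchyKernel_le {ε : ℝ} (hε0 : 0 < ε) (hε1 : ε ≤ 1) (lam : ℝ) (r : ℕ) :
    ∀ᵐ x : ℝ, ‖cauchyKernel ε lam r x‖ ≤ 4 * (jb x ^ (r + 1) / jb x) := by
  filter_upwards [ae_ne_real lam] with x hx
  rw [pow_succ, mul_div_cancel_right₀ _ (jb_ne_zero x)]
  exact norm_cauchyKernel_le hε0 hε1 hx r

theorem exists_tendsto_cauchyKernel {ε : ℝ} (hε : 0 < ε) (lam : ℝ) {l : Filter ℝ}
    (hl : l = 𝓝[<] lam ∨ l = 𝓝[>] lam) (r : ℕ) : ∃ ℓ, Tendsto (cauchyKernel ε lam r) l (𝓝 ℓ) := by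
  cases r with
  | zero =>
    rcases hl with rfl | rfl
    · exact ⟨_, tendsto_cauchyKernel_zero_left hε lam⟩
    · exact ⟨_, tendsto_cauchyKernel_zero_right hε lam⟩
  | succ r =>
    obtain ⟨ℓ, h⟩ := exists_tendsto_cauchyKernel hε lam hl r
    refine ⟨_, tendsto_cauchyKernel_succ ?_ h⟩
    rcases hl with rfl | rfl <;> exact nhdsWithin_le_nhds

section IntegrationByParts

variable {a ε : ℝ} {g : ℝ → ℂ}

theorem MemT.integrable_mul_edgePair (ha : a ≤ 0) (hg : MemT a g) (hε0 : 0 < ε) (hε1 : ε ≤ 1)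
    (lam : ℝ) (r : ℕ) : Integrable fun x => iteratedDeriv r g x * edgePair ε lam r x :=
  hg.integrable_iteratedDeriv_mul ha (by positivity) (measurable_edgePair ε lam r)
    (.of_forall fun x => norm_edgePair_le hε0 hε1 lam x r)

theorem MemT.integrable_mul_cauchyKernel (ha : a ≤ 0) (hg : MemT a g) (hε0 : 0 < ε) (hε1 : ε ≤ 1)
    (lam : ℝ) (r : ℕ) : Integrable fun x => iteratedDeriv (r + 1) g x * cauchyKernel ε lam r x :=
  hg.integrable_iteratedDeriv_mul ha zero_le_four (measurable_cauchyKernel ε lam r)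
    (ae_norm_cauchyKernel_le hε0 hε1 lam r)

theorem MemT.integrable_mul_cauchyKernel_div (ha : a ≤ 0) (hg : MemT a g) (hε0 : 0 < ε)
    (hε1 : ε ≤ 1) (lam : ℝ) (r : ℕ) :
    Integrable fun x => (iteratedDeriv r g * cauchyKernel ε lam r) x / (jb x : ℂ) := by
  have h := hg.integrable_iteratedDeriv_mul (r := r) ha zero_le_four
    (k := fun x => cauchyKernel ε lam r x / (jb x : ℂ))
    ((measurable_cauchyKernel ε lam r).div
      (Complex.measurable_ofReal.comp continuous_jb.measurable)) (by
      filter_upwards [ae_ne_real lam] with x hx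
      rw [norm_div, Complex.norm_real, Real.norm_of_nonneg (jb_pos x).le, mul_div_assoc']
      have := jb_pos x
      gcongr
      exact norm_cauchyKernel_le hε0 hε1 hx r)
  simpa only [Pi.mul_apply, mul_div_assoc] using h

theorem MemT.integral_mul_edgePair_zero (ha : a ≤ 0) (hg : MemT a g) (hε0 : 0 < ε) (hε1 : ε ≤ 1)
    (lam : ℝ) : ∫ x, iteratedDeriv 0 g x * edgePair ε lam 0 x = 2 * Real.pi * Complex.I * g lam -
      ∫ x, iteratedDeriv 1 g x * cauchyKernel ε lam 0 x := by
  rw [integral_mul_deriv_of_jump (hasDerivAt_iteratedDeriv hg.1 0) (v' := edgePair ε lam 0)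
    (fun x hx => hasDerivAt_cauchyKernel_zero hε0.ne' hx)
    (hg.integrable_mul_edgePair ha hε0 hε1 lam 0) (hg.integrable_mul_cauchyKernel ha hε0 hε1 lam 0)
    (hg.integrable_mul_cauchyKernel_div ha hε0 hε1 lam 0)
    (tendsto_cauchyKernel_zero_left hε0 lam) (tendsto_cauchyKernel_zero_right hε0 lam),
    iteratedDeriv_zero]
  ring

theorem MemT.integral_mul_edgePair_succ (ha : a ≤ 0) (hg : MemT a g) (hε0 : 0 < ε) (hε1 : ε ≤ 1)
    (lam : ℝ) (r : ℕ) : ∫ x, iteratedDeriv (r + 1) g x * edgePair ε lam (r + 1) x =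
      (∫ x, iteratedDeriv (r + 1) g x * cauchyKernel ε lam r x) -
      ∫ x, iteratedDeriv (r + 2) g x * cauchyKernel ε lam (r + 1) x := by
  obtain ⟨ℓ₁, h₁⟩ := exists_tendsto_cauchyKernel hε0 lam (.inl rfl) r
  obtain ⟨ℓ₂, h₂⟩ := exists_tendsto_cauchyKernel hε0 lam (.inr rfl) r
  have hE := hg.integrable_mul_edgePair ha hε0 hε1 lam (r + 1)
  have hK := hg.integrable_mul_cauchyKernel ha hε0 hε1 lam r
  have h := integral_mul_deriv_of_jump (hasDerivAt_iteratedDeriv hg.1 (r + 1))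
    (v' := fun x => edgePair ε lam (r + 1) x - cauchyKernel ε lam r x)
    (fun x hx => hasDerivAt_cauchyKernel_succ hε0.ne' hx r)
    (by
      refine (hE.sub hK).congr (.of_forall fun x => ?_)
      simp only [Pi.mul_apply, Pi.sub_apply, mul_sub])
    (hg.integrable_mul_cauchyKernel ha hε0 hε1 lam (r + 1))
    (hg.integrable_mul_cauchyKernel_div ha hε0 hε1 lam (r + 1))
    (tendsto_cauchyKernel_succ nhdsWithin_le_nhds h₁)
    (tendsto_cauchyKernel_succ nhdsWithin_le_nhds h₂)
  simp only [mul_sub] at h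
  rw [integral_sub hE hK, sub_self] at h
  linear_combination h

theorem MemT.sum_integral_mul_edgePair (ha : a ≤ 0) (hg : MemT a g) {ε : ℕ → ℝ}
    (hε0 : ∀ r, 0 < ε r) (hε1 : ∀ r, ε r ≤ 1) (lam : ℝ) (M : ℕ) :
    ∑ r ∈ Finset.range (M + 1), ∫ x, iteratedDeriv r g x * edgePair (ε r) lam r x =
      2 * Real.pi * Complex.I * g lam -
      (∑ r ∈ Finset.range M, ∫ x, iteratedDeriv (r + 1) g x *
        (cauchyKernel (ε r) lam r x - cauchyKernel (ε (r + 1)) lam r x)) -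
      ∫ x, iteratedDeriv (M + 1) g x * cauchyKernel (ε M) lam M x := by
  induction M with
  | zero => simpa using hg.integral_mul_edgePair_zero ha (hε0 0) (hε1 0) lam
  | succ M ih =>
    rw [Finset.sum_range_succ, ih, Finset.sum_range_succ,
      hg.integral_mul_edgePair_succ ha (hε0 _) (hε1 _) lam M]
    simp only [mul_sub]
    rw [integral_sub (hg.integrable_mul_cauchyKernel ha (hε0 M) (hε1 M) lam M)
      (hg.integrable_mul_cauchyKernel ha (hε0 (M + 1)) (hε1 (M + 1)) lam M)]
    ring

theorem MemT.tendsto_sum_integral_mul_edgePair (ha : a ≤ 0) (hg : MemT a g) {ε : ℕ → ℝ}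
    (hε0 : ∀ r, 0 < ε r) (hε1 : ∀ r, ε r ≤ 1)
    (hε : Tendsto (fun r => ε r * TNorm a (r + 1) g) atTop (𝓝 0)) (lam : ℝ) :
    Tendsto (fun M => (∑ r ∈ Finset.range (M + 1),
        ∫ x, iteratedDeriv r g x * edgePair (ε r) lam r x) +
      ∑ r ∈ Finset.range M, ∫ x, iteratedDeriv (r + 1) g x *
        (cauchyKernel (ε r) lam r x - cauchyKernel (ε (r + 1)) lam r x)) atTop
      (𝓝 (2 * Real.pi * Complex.I * g lam)) := by
  have h : Tendsto (fun M => ∫ x, iteratedDeriv (M + 1) g x * cauchyKernel (ε M) lam M x) atTop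
      (𝓝 0) := by
    refine squeeze_zero_norm' ?_ (by simpa using hε.const_mul 2)
    filter_upwards [eventually_ge_atTop 1] with M hM
    obtain ⟨m, rfl⟩ := Nat.exists_eq_add_of_le' hM
    rw [← mul_assoc]
    refine hg.norm_integral_iteratedDeriv_mul_le ha (by linarith [hε0 (m + 1)]) ?_
    filter_upwards [ae_ne_real lam] with x hx
    rw [pow_succ _ (m + 1), mul_div_cancel_right₀ _ (jb_ne_zero x)]
    exact norm_cauchyKernel_succ_le (hε0 _) (hε1 _) hx m
  have h1 := h.const_sub (2 * Real.pi * Complex.I * g lam)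
  rw [sub_zero] at h1
  refine h1.congr fun M => ?_
  rw [hg.sum_integral_mul_edgePair ha hε0 hε1]
  ring

end IntegrationByParts

theorem cauchyKernel_sub_eq_setIntegral {lam x : ℝ} (hx : x ≠ lam) {ε ε' : ℝ} (h0 : 0 ≤ ε')
    (h1 : ε' ≤ ε) (r : ℕ) : cauchyKernel ε lam r x - cauchyKernel ε' lam r x =
      ∫ τ in Set.Ioc (-ε) ε \ Set.Ioc (-ε') ε', segmentKernel lam r x τ := by
  rw [cauchyKernel_eq_integral hx, cauchyKernel_eq_integral hx,
    intervalIntegral.integral_of_le (by linarith), intervalIntegral.integral_of_le (by linarith),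
    setIntegral_sdiff measurableSet_Ioc
      ((continuous_segmentKernel hx r).integrableOn_Icc.mono_set Set.Ioc_subset_Icc_self)
      (Set.Ioc_subset_Ioc (by linarith) h1)]

/-! ### Assembling a Cauchy-type representation from countably many pieces -/

theorem norm_mul_inv_le_cauchyWeight {a : ℝ} (ha : a ≤ 0) {z : ℂ} (hz : z.im ≠ 0)
    (hzb : |z.im| ≤ jb z.re) (w : ℂ) (x : ℝ) :
    ‖w * ((x : ℂ) - z)⁻¹‖ ≤ ‖w‖ * cauchyWeight a 1 z := by
  rw [norm_mul]
  gcongr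
  simpa using norm_pow_mul_prod_le ha hz hzb (le_refl 0) fun _ => x

theorem exists_isCauchyRep_of_countable {a : ℝ} (ha : a ≤ 0) {g : ℝ → ℂ} {ι X : Type} [Countable ι]
    [MeasurableSpace X] {μ : Measure X} [SigmaFinite μ] {z w : ι → X → ℂ}
    (hz : ∀ i, Measurable (z i)) (hw : ∀ i, Measurable (w i)) (him : ∀ i ω, (z i ω).im ≠ 0)
    (hle : ∀ i ω, |(z i ω).im| ≤ jb (z i ω).re)
    (hfin : ∀ K, 1 ≤ K →
      ∑' i, ∫⁻ ω, ENNReal.ofReal (‖w i ω‖ * cauchyWeight a K (z i ω)) ∂μ ≠ ⊤)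
    {s : ℕ → Finset ι} (hs : Tendsto s atTop atTop)
    (hg : ∀ x : ℝ, Tendsto (fun M => ∑ i ∈ s M, ∫ ω, w i ω * ((x : ℂ) - z i ω)⁻¹ ∂μ) atTop
      (𝓝 (g x))) :
    ∃ (Ω : Type) (_ : MeasurableSpace Ω) (ν : Measure Ω) (z' w' : Ω → ℂ),
      IsCauchyRep a g ν z' w' ∧
      ∀ K, ∫⁻ ω, ENNReal.ofReal (‖w' ω‖ * cauchyWeight a K (z' ω)) ∂ν =
        ∑' i, ∫⁻ ω, ENNReal.ofReal (‖w i ω‖ * cauchyWeight a K (z i ω)) ∂μ := by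
  let mι : MeasurableSpace ι := ⊤
  have : DiscreteMeasurableSpace ι := ⟨fun _ => trivial⟩
  have hz' : Measurable fun ω : ι × X => z ω.1 ω.2 := measurable_from_prod_countable_right hz
  have hw' : Measurable fun ω : ι × X => w ω.1 ω.2 := measurable_from_prod_countable_right hw
  have hmeas : ∀ K, Measurable fun ω : ι × X => ‖w ω.1 ω.2‖ * cauchyWeight a K (z ω.1 ω.2) := by
    intro K
    unfold cauchyWeight
    have h1 : Measurable fun ω : ι × X => (z ω.1 ω.2).re := Complex.measurable_re.comp hz'
    have h2 : Measurable fun ω : ι × X => (z ω.1 ω.2).im := Complex.measurable_im.comp hz'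
    have h3 : Measurable fun ω : ι × X => jb (z ω.1 ω.2).re := continuous_jb.measurable.comp h1
    exact hw'.norm.mul ((h3.pow_const _).mul (h2.norm.pow_const K).inv)
  have hlin : ∀ K, ∫⁻ ω : ι × X, ENNReal.ofReal (‖w ω.1 ω.2‖ * cauchyWeight a K (z ω.1 ω.2))
      ∂(Measure.count.prod μ) =
      ∑' i, ∫⁻ ω, ENNReal.ofReal (‖w i ω‖ * cauchyWeight a K (z i ω)) ∂μ := by
    intro K
    rw [lintegral_prod _ (hmeas K).ennreal_ofReal.aemeasurable, lintegral_count]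
  have hint : ∀ K, 1 ≤ K → Integrable
      (fun ω : ι × X => ‖w ω.1 ω.2‖ * cauchyWeight a K (z ω.1 ω.2)) (Measure.count.prod μ) := by
    intro K hK
    refine ⟨(hmeas K).aestronglyMeasurable, ?_⟩
    rw [hasFiniteIntegral_iff_ofReal (.of_forall fun ω =>
      mul_nonneg (norm_nonneg _) (cauchyWeight_nonneg _ _ _)), hlin]
    exact (hfin K hK).lt_top
  refine ⟨ι × X, inferInstance, Measure.count.prod μ, fun ω => z ω.1 ω.2, fun ω => w ω.1 ω.2,
    ⟨inferInstance, hz', hw', fun _ => him _ _, fun _ => hle _ _, hint, fun x => ?_⟩, hlin⟩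
  have hF : Integrable (fun ω : ι × X => w ω.1 ω.2 * ((x : ℂ) - z ω.1 ω.2)⁻¹)
      (Measure.count.prod μ) :=
    (hint 1 le_rfl).mono' (hw'.mul (measurable_const.sub hz').inv).aestronglyMeasurable
      (.of_forall fun ω => norm_mul_inv_le_cauchyWeight ha (him _ _) (hle _ _) _ x)
  have hS := (integrable_count_iff.mp hF.integral_prod_left).of_norm
  rw [integral_prod _ hF, integral_countable hF.integral_prod_left]
  simp only [Measure.real, Measure.count_singleton, ENNReal.toReal_one, one_smul]
  exact tendsto_nhds_unique (hg x) (hS.hasSum.comp hs)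

theorem tendsto_disjSum_range_atTop :
    Tendsto (fun M => (Finset.range M).disjSum (Finset.range (M + 1) ×ˢ (Finset.univ : Finset Bool)))
      atTop atTop := by
  refine tendsto_atTop_finset_of_monotone (fun M M' h => ?_) fun i => ?_
  · exact Finset.disjSum_mono (Finset.range_mono h)
      (Finset.product_subset_product_left (Finset.range_mono (by omega)))
  · rcases i with r | ⟨r, b⟩
    · exact ⟨r + 1, by simp⟩
    · exact ⟨r, by simp⟩

/-! ### The Cauchy-type representation of a function in `T^a` -/

/-- The layers of heights between two consecutive cutoffs. -/
def cutoffLayer (ε : ℕ → ℝ) (r : ℕ) : Set ℝ :=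
  Set.Ioc (-ε r) (ε r) \ Set.Ioc (-ε (r + 1)) (ε (r + 1))

theorem measurableSet_cutoffLayer (ε : ℕ → ℝ) (r : ℕ) : MeasurableSet (cutoffLayer ε r) :=
  measurableSet_Ioc.diff measurableSet_Ioc

theorem abs_mem_of_mem_cutoffLayer {ε : ℕ → ℝ} {r : ℕ} {τ : ℝ} (h : τ ∈ cutoffLayer ε r) :
    ε (r + 1) ≤ |τ| ∧ |τ| ≤ ε r := by
  refine ⟨?_, abs_le.mpr ⟨h.1.1.le, h.1.2⟩⟩
  by_contra! hlt
  rw [abs_lt] at hlt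
  exact h.2 ⟨hlt.1, hlt.2.le⟩

theorem volume_cutoffLayer_le (ε : ℕ → ℝ) (r : ℕ) :
    volume (cutoffLayer ε r) ≤ ENNReal.ofReal (2 * ε r) := by
  refine (measure_mono Set.sdiff_subset).trans (le_of_eq ?_)
  rw [Real.volume_Ioc]
  congr 1
  ring

/-- The sign `±1` of an end of the segment. -/
def endSign (b : Bool) : ℝ := if b then 1 else -1

open scoped Classical in
/-- The height, in multiples of `⟨x⟩`, of the poles of the Cauchy-type representation. -/
noncomputable def poleHeight (ε : ℕ → ℝ) : ℕ ⊕ ℕ × Bool → ℝ → ℝ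
  | .inl r, τ => if τ ∈ cutoffLayer ε r then τ else 1
  | .inr (r, b), _ => endSign b * ε r

/-- The poles of the Cauchy-type representation. -/
noncomputable def repPole (ε : ℕ → ℝ) (i : ℕ ⊕ ℕ × Bool) (ω : ℝ × ℝ) : ℂ :=
  (ω.1 : ℂ) + stripHeight (poleHeight ε i ω.2) ω.1

/-- The weights of the Cauchy-type representation. -/
noncomputable def repWeight (ε : ℕ → ℝ) (g : ℝ → ℂ) : ℕ ⊕ ℕ × Bool → ℝ × ℝ → ℂ
  | .inl r, (x, τ) => (2 * Real.pi * Complex.I)⁻¹ * (iteratedDeriv (r + 1) g x *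
      (cutoffLayer ε r).indicator (fun τ =>
        stripHeight τ x ^ r / (r.factorial : ℂ) * (Complex.I * (jb x : ℂ))) τ)
  | .inr (r, b), (x, τ) => (2 * Real.pi * Complex.I)⁻¹ * ((endSign b : ℂ) * (iteratedDeriv r g x *
      (stripHeight (endSign b * ε r) x ^ r / (r.factorial : ℂ) *
        (1 + stripHeight (endSign b * ε r) x * (x / jb x ^ 2 : ℝ))))) *
          (Set.Ioc (0 : ℝ) 1).indicator 1 τ

theorem abs_endSign (b : Bool) : |endSign b| = 1 := by
  cases b <;> simp [endSign]

theorem abs_poleHeight_mem {ε : ℕ → ℝ} (hε0 : ∀ r, 0 < ε r) (hε1 : ∀ r, ε r ≤ 1)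
    (i : ℕ ⊕ ℕ × Bool) (τ : ℝ) : 0 < |poleHeight ε i τ| ∧ |poleHeight ε i τ| ≤ 1 := by
  rcases i with r | ⟨r, b⟩
  · rw [poleHeight]
    split_ifs with h
    · have := abs_mem_of_mem_cutoffLayer h
      exact ⟨(hε0 _).trans_le this.1, this.2.trans (hε1 _)⟩
    · simp
  · rw [poleHeight, abs_mul, abs_endSign, one_mul, abs_of_pos (hε0 r)]
    exact ⟨hε0 r, hε1 r⟩

theorem repPole_re (ε : ℕ → ℝ) (i : ℕ ⊕ ℕ × Bool) (ω : ℝ × ℝ) : (repPole ε i ω).re = ω.1 := by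
  simp [repPole, stripHeight_re]

theorem repPole_im (ε : ℕ → ℝ) (i : ℕ ⊕ ℕ × Bool) (ω : ℝ × ℝ) :
    (repPole ε i ω).im = poleHeight ε i ω.2 * jb ω.1 := by
  simp [repPole, stripHeight_im]

theorem cauchyWeight_repPole (a : ℝ) (K : ℕ) (ε : ℕ → ℝ) (i : ℕ ⊕ ℕ × Bool) (ω : ℝ × ℝ) :
    cauchyWeight a K (repPole ε i ω) =
      jb ω.1 ^ (-1 - a) * (|poleHeight ε i ω.2| ^ K)⁻¹ := by
  have hb := jb_pos ω.1
  rw [cauchyWeight, repPole_re, repPole_im, abs_mul, abs_of_pos hb, mul_pow, mul_inv,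
    show (K : ℝ) - 1 - a = (-1 - a) + (K : ℕ) by ring, Real.rpow_add_natCast hb.ne']
  field_simp

theorem measurable_poleHeight (ε : ℕ → ℝ) (i : ℕ ⊕ ℕ × Bool) : Measurable (poleHeight ε i) := by
  rcases i with r | ⟨r, b⟩
  · exact Measurable.ite (measurableSet_cutoffLayer ε r) measurable_id measurable_const
  · exact measurable_const

theorem Measurable.stripHeight {X : Type*} [MeasurableSpace X] {h x : X → ℝ} (hh : Measurable h)
    (hx : Measurable x) : Measurable fun ω => stripHeight (h ω) (x ω) :=
  measurable_const.mul (Complex.measurable_ofReal.comp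
    (hh.mul (continuous_jb.measurable.comp hx)))

theorem measurable_repPole (ε : ℕ → ℝ) (i : ℕ ⊕ ℕ × Bool) : Measurable (repPole ε i) :=
  (Complex.measurable_ofReal.comp measurable_fst).add
    (((measurable_poleHeight ε i).comp measurable_snd).stripHeight measurable_fst)

theorem measurable_repWeight (ε : ℕ → ℝ) {g : ℝ → ℂ} (hg : ContDiff ℝ (⊤ : ℕ∞) g)
    (i : ℕ ⊕ ℕ × Bool) : Measurable (repWeight ε g i) := by
  have hd : ∀ r, Measurable fun ω : ℝ × ℝ => iteratedDeriv r g ω.1 := fun r =>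
    (continuous_iteratedDeriv_of_contDiff hg r).measurable.comp measurable_fst
  have hb : Measurable fun ω : ℝ × ℝ => jb ω.1 := continuous_jb.measurable.comp measurable_fst
  rcases i with r | ⟨r, b⟩
  · have h1 : Measurable fun ω : ℝ × ℝ =>
        (Prod.snd ⁻¹' cutoffLayer ε r).indicator (fun ω : ℝ × ℝ =>
          _root_.stripHeight ω.2 ω.1 ^ r / (r.factorial : ℂ) * (Complex.I * (jb ω.1 : ℂ))) ω :=
      Measurable.indicator ((((measurable_snd.stripHeight measurable_fst).pow_const r).div_const
        _).mul (measurable_const.mul (Complex.measurable_ofReal.comp hb)))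
        (measurable_snd (measurableSet_cutoffLayer ε r))
    exact measurable_const.mul ((hd (r + 1)).mul h1)
  · have h1 : Measurable fun ω : ℝ × ℝ => _root_.stripHeight (endSign b * ε r) ω.1 :=
      measurable_const.stripHeight measurable_fst
    have h2 : Measurable fun ω : ℝ × ℝ => (((ω.1 / jb ω.1 ^ 2 : ℝ)) : ℂ) :=
      Complex.measurable_ofReal.comp (measurable_fst.div (hb.pow_const 2))
    have h3 : Measurable fun ω : ℝ × ℝ => (Set.Ioc (0 : ℝ) 1).indicator (1 : ℝ → ℂ) ω.2 :=
      (measurable_one.indicator measurableSet_Ioc).comp measurable_snd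
    exact (measurable_const.mul (measurable_const.mul ((hd r).mul
      (((h1.pow_const r).div_const _).mul (measurable_const.add (h1.mul h2)))))).mul h3

theorem norm_two_pi_I_inv : ‖((2 * Real.pi * Complex.I)⁻¹ : ℂ)‖ = (2 * Real.pi)⁻¹ := by
  rw [norm_inv, norm_mul, norm_mul, Complex.norm_I, Complex.norm_two, Complex.norm_real,
    Real.norm_of_nonneg Real.pi_pos.le, mul_one]

theorem two_pi_inv_le : (2 * Real.pi)⁻¹ ≤ 1 / 2 := by
  rw [inv_eq_one_div]
  exact one_div_le_one_div_of_le two_pos (by linarith [Real.pi_gt_three])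

theorem jb_pow_mul_rpow (a x : ℝ) (r : ℕ) :
    jb x ^ r * jb x ^ (-1 - a) = jb x ^ ((r : ℝ) - a - 1) := by
  rw [← Real.rpow_natCast, ← Real.rpow_add (jb_pos x)]
  congr 1
  ring

theorem norm_repWeight_inl_mul_le (a : ℝ) (g : ℝ → ℂ) (ε : ℕ → ℝ) (r K : ℕ) (x τ : ℝ) :
    ‖repWeight ε g (.inl r) (x, τ)‖ * cauchyWeight a K (repPole ε (.inl r) (x, τ)) ≤
      tWeight a (r + 1) g x *
        (cutoffLayer ε r).indicator (fun τ => |τ| ^ r * (|τ| ^ K)⁻¹) τ := by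
  rw [cauchyWeight_repPole, repWeight, poleHeight]
  by_cases h : τ ∈ cutoffLayer ε r
  · rw [if_pos h, Set.indicator_of_mem h, Set.indicator_of_mem h, norm_mul, norm_mul,
      norm_two_pi_I_inv, norm_mul, norm_mul, Complex.norm_I, one_mul, Complex.norm_real,
      Real.norm_of_nonneg (jb_pos x).le, tWeight, ← jb_pow_mul_rpow]
    have hb := (jb_pos x).le
    have hb' : 0 ≤ jb x ^ (-1 - a) := Real.rpow_nonneg hb _
    have h1 : ‖stripHeight τ x ^ r / (r.factorial : ℂ)‖ ≤ (|τ| * jb x) ^ r := by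
      refine (norm_div_factorial_le _ _).trans ?_
      rw [norm_pow, norm_stripHeight]
    calc _ ≤ 1 * (‖iteratedDeriv (r + 1) g x‖ * ((|τ| * jb x) ^ r * jb x)) *
          (jb x ^ (-1 - a) * (|τ| ^ K)⁻¹) := by
          gcongr
          linarith [two_pi_inv_le]
      _ = _ := by ring
  · rw [Set.indicator_of_notMem h, Set.indicator_of_notMem h]
    simp

theorem norm_repWeight_inr_mul_le (a : ℝ) (g : ℝ → ℂ) {ε : ℕ → ℝ} (hε0 : ∀ r, 0 < ε r)
    (hε1 : ∀ r, ε r ≤ 1) (r K : ℕ) (b : Bool) (x τ : ℝ) :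
    ‖repWeight ε g (.inr (r, b)) (x, τ)‖ * cauchyWeight a K (repPole ε (.inr (r, b)) (x, τ)) ≤
      tWeight a r g x * (Set.Ioc (0 : ℝ) 1).indicator (fun _ => ε r ^ r * (ε r ^ K)⁻¹) τ := by
  rw [cauchyWeight_repPole, repWeight, poleHeight]
  by_cases h : τ ∈ Set.Ioc (0 : ℝ) 1
  · have hε := (hε0 r).le
    have hε' : |endSign b * ε r| = ε r := by rw [abs_mul, abs_endSign, one_mul, abs_of_nonneg hε]
    have hb := jb_pos x
    have hb' : 0 ≤ jb x ^ (-1 - a) := Real.rpow_nonneg hb.le _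
    rw [Set.indicator_of_mem h, Set.indicator_of_mem h, Pi.one_apply, mul_one, norm_mul, norm_mul,
      norm_two_pi_I_inv, norm_mul, norm_mul, Complex.norm_real, Real.norm_eq_abs, abs_endSign,
      one_mul, hε', tWeight, ← jb_pow_mul_rpow]
    have h1 : ‖stripHeight (endSign b * ε r) x ^ r / (r.factorial : ℂ)‖ ≤ (ε r * jb x) ^ r := by
      refine (norm_div_factorial_le _ _).trans ?_
      rw [norm_pow, norm_stripHeight, hε']
    have h2 : ‖1 + stripHeight (endSign b * ε r) x * (x / jb x ^ 2 : ℝ)‖ ≤ 2 := by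
      have h3 : ε r * jb x * (|x| / jb x ^ 2) = ε r * (|x| / jb x) := by
        field_simp
      have h4 : |x| / jb x ≤ 1 := (div_le_one hb).mpr (abs_le_jb x)
      refine (norm_add_le _ _).trans ?_
      rw [norm_mul, norm_stripHeight, hε', Complex.norm_real, Real.norm_eq_abs, abs_div,
        abs_of_pos (pow_pos hb 2), norm_one, h3]
      linarith [mul_le_one₀ (hε1 r) (by positivity) h4]
    calc _ ≤ 1 / 2 * (‖iteratedDeriv r g x‖ * ((ε r * jb x) ^ r * 2)) *
          (jb x ^ (-1 - a) * (ε r ^ K)⁻¹) := by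
          gcongr
          exact two_pi_inv_le
      _ = _ := by ring
  · rw [Set.indicator_of_notMem h, Set.indicator_of_notMem h]
    simp

theorem lintegral_prod_le_mul {F : ℝ × ℝ → ℝ} {p q : ℝ → ℝ} {B : ℝ≥0∞} (hp : Integrable p)
    (hp0 : ∀ x, 0 ≤ p x) (hq : Measurable q) (hF : ∀ x τ, F (x, τ) ≤ p x * q τ)
    (hB : ∫⁻ τ, ENNReal.ofReal (q τ) ≤ B) :
    ∫⁻ ω, ENNReal.ofReal (F ω) ≤ ENNReal.ofReal (∫ x, p x) * B := by
  calc ∫⁻ ω, ENNReal.ofReal (F ω)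
      ≤ ∫⁻ ω : ℝ × ℝ, ENNReal.ofReal (p ω.1) * ENNReal.ofReal (q ω.2) := by
        refine lintegral_mono fun ω => ?_
        rw [← ENNReal.ofReal_mul (hp0 _)]
        exact ENNReal.ofReal_le_ofReal (hF ω.1 ω.2)
    _ = (∫⁻ x, ENNReal.ofReal (p x)) * ∫⁻ τ, ENNReal.ofReal (q τ) := by
        rw [Measure.volume_eq_prod]
        exact lintegral_prod_mul hp.aestronglyMeasurable.aemeasurable.ennreal_ofReal
          hq.ennreal_ofReal.aemeasurable
    _ ≤ _ := by
        rw [ofReal_integral_eq_lintegral_ofReal hp (.of_forall hp0)]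
        gcongr

theorem lintegral_ofReal_indicator_le {s : Set ℝ} {f : ℝ → ℝ} {c : ℝ} (h : ∀ τ ∈ s, f τ ≤ c) :
    ∫⁻ τ, ENNReal.ofReal (s.indicator f τ) ≤ ENNReal.ofReal c * volume s := by
  refine (lintegral_mono fun τ => ?_).trans (lintegral_indicator_const_le s (ENNReal.ofReal c))
  by_cases hτ : τ ∈ s
  · rw [Set.indicator_of_mem hτ, Set.indicator_of_mem hτ]
    exact ENNReal.ofReal_le_ofReal (h τ hτ)
  · rw [Set.indicator_of_notMem hτ, Set.indicator_of_notMem hτ, ENNReal.ofReal_zero]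

theorem pow_mul_inv_pow_le {t : ℝ} (h0 : 0 < t) (h1 : t ≤ 1) {K r : ℕ} (h : K ≤ r) :
    t ^ r * (t ^ K)⁻¹ ≤ 1 := by
  rw [← div_eq_mul_inv, div_le_one (by positivity)]
  exact pow_le_pow_of_le_one h0.le h1 h

theorem pow_mul_inv_pow_le_self {t : ℝ} (h0 : 0 < t) (h1 : t ≤ 1) {K r : ℕ} (h : K < r) :
    t ^ r * (t ^ K)⁻¹ ≤ t := by
  obtain ⟨m, rfl⟩ := Nat.exists_eq_add_of_lt h
  have := mul_le_of_le_one_right h0.le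
    (pow_mul_inv_pow_le h0 h1 (Nat.le_add_right K m))
  calc _ = t * (t ^ (K + m) * (t ^ K)⁻¹) := by ring
    _ ≤ t := this

section Bounds

variable {a : ℝ} {g : ℝ → ℂ} {ε : ℕ → ℝ}

/-- The `K`-th moment of the `i`-th piece of the Cauchy-type representation. -/
noncomputable def repMoment (a : ℝ) (ε : ℕ → ℝ) (g : ℝ → ℂ) (K : ℕ) (i : ℕ ⊕ ℕ × Bool) : ℝ≥0∞ :=
  ∫⁻ ω, ENNReal.ofReal (‖repWeight ε g i ω‖ * cauchyWeight a K (repPole ε i ω))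

theorem MemT.repMoment_inl_le (hg : MemT a g) {c : ℝ} {r K : ℕ}
    (hc : ∀ τ ∈ cutoffLayer ε r, |τ| ^ r * (|τ| ^ K)⁻¹ ≤ c) :
    repMoment a ε g K (.inl r) ≤ ENNReal.ofReal (TNorm a (r + 1) g) *
      (ENNReal.ofReal c * volume (cutoffLayer ε r)) :=
  lintegral_prod_le_mul (hg.2 (r + 1)) (tWeight_nonneg a (r + 1) g)
    (Measurable.indicator ((measurable_id.norm.pow_const r).mul (measurable_id.norm.pow_const K).inv)
      (measurableSet_cutoffLayer ε r))
    (fun x τ => norm_repWeight_inl_mul_le a g ε r K x τ) (lintegral_ofReal_indicator_le hc)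

theorem MemT.repMoment_inr_le (hg : MemT a g) (hε0 : ∀ r, 0 < ε r) (hε1 : ∀ r, ε r ≤ 1)
    (r K : ℕ) (b : Bool) : repMoment a ε g K (.inr (r, b)) ≤
      ENNReal.ofReal (TNorm a r g) * ENNReal.ofReal (ε r ^ r * (ε r ^ K)⁻¹) := by
  refine lintegral_prod_le_mul (hg.2 r) (tWeight_nonneg a r g)
    (measurable_const.indicator measurableSet_Ioc)
    (fun x τ => norm_repWeight_inr_mul_le a g hε0 hε1 r K b x τ)
    ((lintegral_ofReal_indicator_le (c := ε r ^ r * (ε r ^ K)⁻¹) fun _ _ => le_rfl).trans ?_)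
  simp

theorem MemT.repMoment_ne_top (hg : MemT a g) (hε0 : ∀ r, 0 < ε r) (hε1 : ∀ r, ε r ≤ 1) (K : ℕ)
    (i : ℕ ⊕ ℕ × Bool) : repMoment a ε g K i ≠ ⊤ := by
  rcases i with r | ⟨r, b⟩
  · refine ne_top_of_le_ne_top ?_ (hg.repMoment_inl_le (c := (ε (r + 1) ^ K)⁻¹) fun τ hτ => ?_)
    · exact ENNReal.mul_ne_top ENNReal.ofReal_ne_top (ENNReal.mul_ne_top ENNReal.ofReal_ne_top
        (ne_top_of_le_ne_top ENNReal.ofReal_ne_top (volume_cutoffLayer_le ε r)))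
    · obtain ⟨h1, h2⟩ := abs_mem_of_mem_cutoffLayer hτ
      have h0 := hε0 (r + 1)
      calc _ ≤ 1 * (ε (r + 1) ^ K)⁻¹ := by
            gcongr
            exact pow_le_one₀ (abs_nonneg τ) (h2.trans (hε1 r))
        _ = _ := one_mul _
  · exact ne_top_of_le_ne_top (ENNReal.mul_ne_top ENNReal.ofReal_ne_top ENNReal.ofReal_ne_top)
      (hg.repMoment_inr_le hε0 hε1 r K b)

/-- The three pieces of index `r` together have a small moment, provided that either `K < r` or
the cutoffs of index at most `max r K` are trivial. -/
theorem MemT.repMoment_add_le (hg : MemT a g) (hε0 : ∀ r, 0 < ε r) (hε1 : ∀ r, ε r ≤ 1) {r K : ℕ}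
    (h : K < r ∨ ∀ q, q ≤ r ∨ q ≤ K → ε q = 1) :
    repMoment a ε g K (.inl r) + (repMoment a ε g K (.inr (r, true)) +
      repMoment a ε g K (.inr (r, false))) ≤
        ENNReal.ofReal (2 * (ε r * (TNorm a (r + 1) g + TNorm a r g))) := by
  have hE := (hε0 r).le
  have hT := TNorm_nonneg a r g
  have hT' := TNorm_nonneg a (r + 1) g
  have h1 : repMoment a ε g K (.inl r) ≤ ENNReal.ofReal (2 * (ε r * TNorm a (r + 1) g)) := by
    by_cases hrK : K ≤ r
    · refine (hg.repMoment_inl_le (c := 1) fun τ hτ => ?_).trans ?_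
      · obtain ⟨h2, h3⟩ := abs_mem_of_mem_cutoffLayer hτ
        exact pow_mul_inv_pow_le ((hε0 _).trans_le h2) (h3.trans (hε1 r)) hrK
      · rw [ENNReal.ofReal_one, one_mul,
          show 2 * (ε r * TNorm a (r + 1) g) = TNorm a (r + 1) g * (2 * ε r) by ring,
          ENNReal.ofReal_mul hT']
        gcongr
        exact volume_cutoffLayer_le ε r
    · have h2 : cutoffLayer ε r = ∅ := by
        rcases h with h | h
        · omega
        · rw [cutoffLayer, h r (.inl le_rfl), h (r + 1) (.inr (by omega)), Set.sdiff_self]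
      refine (hg.repMoment_inl_le (c := 0) fun τ hτ => ?_).trans (by simp)
      rw [h2] at hτ
      exact hτ.elim
  have h2 : ∀ b, repMoment a ε g K (.inr (r, b)) ≤ ENNReal.ofReal (ε r * TNorm a r g) := by
    intro b
    refine (hg.repMoment_inr_le hε0 hε1 r K b).trans ?_
    rw [mul_comm (ε r), ENNReal.ofReal_mul hT]
    gcongr
    rcases h with h | h
    · exact pow_mul_inv_pow_le_self (hε0 r) (hε1 r) h
    · simp [h r (.inl le_rfl)]
  refine (add_le_add h1 (add_le_add (h2 _) (h2 _))).trans (le_of_eq ?_)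
  rw [← ENNReal.ofReal_add (by positivity) (by positivity),
    ← ENNReal.ofReal_add (by positivity) (by positivity)]
  congr 1
  ring

theorem tsum_sum_prod_bool (M : ℕ ⊕ ℕ × Bool → ℝ≥0∞) :
    ∑' i, M i = ∑' r, (M (.inl r) + (M (.inr (r, true)) + M (.inr (r, false)))) := by
  have h : ∑' i : ℕ × Bool, M (.inr i) = ∑' r, ∑' b, M (.inr (r, b)) :=
    ENNReal.tsum_prod (f := fun r b => M (.inr (r, b)))
  rw [ENNReal.summable.tsum_sum ENNReal.summable, ENNReal.tsum_add, h]
  simp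

theorem MemT.tsum_repMoment_ne_top (hg : MemT a g) (hε0 : ∀ r, 0 < ε r) (hε1 : ∀ r, ε r ≤ 1)
    (hs : Summable fun r => ε r * (TNorm a (r + 1) g + TNorm a r g)) (K : ℕ) :
    ∑' i, repMoment a ε g K i ≠ ⊤ := by
  rw [tsum_sum_prod_bool, ← ENNReal.summable.sum_add_tsum_nat_add' (k := K + 1)]
  refine ENNReal.add_ne_top.mpr ⟨ENNReal.sum_ne_top.mpr fun r _ => ?_, ?_⟩
  · exact ENNReal.add_ne_top.mpr ⟨hg.repMoment_ne_top hε0 hε1 K _,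
      ENNReal.add_ne_top.mpr ⟨hg.repMoment_ne_top hε0 hε1 K _, hg.repMoment_ne_top hε0 hε1 K _⟩⟩
  · have h2 := ((summable_nat_add_iff (K + 1)).mpr hs).mul_left 2
    refine ne_top_of_le_ne_top h2.tsum_ofReal_ne_top
      (ENNReal.tsum_le_tsum fun r => hg.repMoment_add_le hε0 hε1 (.inl (by omega)))

theorem MemT.tsum_repMoment_le (hg : MemT a g) (hε0 : ∀ r, 0 < ε r) (hε1 : ∀ r, ε r ≤ 1)
    (hs : Summable fun r => ε r * (TNorm a (r + 1) g + TNorm a r g)) {K N : ℕ} (hK : K ≤ N)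
    (hN : ∀ r ≤ N, ε r = 1) : ∑' i, repMoment a ε g K i ≤
      ENNReal.ofReal (2 * ∑' r, ε r * (TNorm a (r + 1) g + TNorm a r g)) := by
  rw [tsum_sum_prod_bool, ← tsum_mul_left, ENNReal.ofReal_tsum_of_nonneg _ (hs.mul_left 2)]
  · refine ENNReal.tsum_le_tsum fun r => hg.repMoment_add_le hε0 hε1 ?_
    by_cases h : K < r
    · exact .inl h
    · exact .inr fun q hq => hN q (by omega)
  · intro r
    have := (hε0 r).le
    have := TNorm_nonneg a r g
    have := TNorm_nonneg a (r + 1) g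
    positivity

end Bounds

section Existence

variable {a : ℝ} {g : ℝ → ℂ} {ε : ℕ → ℝ}

theorem repPole_im_ne_zero (hε0 : ∀ r, 0 < ε r) (hε1 : ∀ r, ε r ≤ 1) (i : ℕ ⊕ ℕ × Bool)
    (ω : ℝ × ℝ) : (repPole ε i ω).im ≠ 0 := by
  rw [repPole_im]
  exact mul_ne_zero (abs_pos.mp (abs_poleHeight_mem hε0 hε1 i ω.2).1) (jb_ne_zero _)

theorem abs_repPole_im_le (hε0 : ∀ r, 0 < ε r) (hε1 : ∀ r, ε r ≤ 1) (i : ℕ ⊕ ℕ × Bool)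
    (ω : ℝ × ℝ) : |(repPole ε i ω).im| ≤ jb (repPole ε i ω).re := by
  rw [repPole_im, repPole_re, abs_mul, abs_of_pos (jb_pos _)]
  exact mul_le_of_le_one_left (jb_pos _).le (abs_poleHeight_mem hε0 hε1 i ω.2).2

theorem ofReal_sub_repPole (ε : ℕ → ℝ) (i : ℕ ⊕ ℕ × Bool) (lam x τ : ℝ) :
    (lam : ℂ) - repPole ε i (x, τ) =
      ((lam - x : ℝ) : ℂ) - stripHeight (poleHeight ε i τ) x := by
  rw [repPole]
  push_cast
  ring

theorem MemT.integrable_repWeight_mul (ha : a ≤ 0) (hg : MemT a g) (hε0 : ∀ r, 0 < ε r)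
    (hε1 : ∀ r, ε r ≤ 1) (i : ℕ ⊕ ℕ × Bool) (lam : ℝ) :
    Integrable fun ω => repWeight ε g i ω * ((lam : ℂ) - repPole ε i ω)⁻¹ := by
  refine ⟨((measurable_repWeight ε hg.1 i).mul
    (measurable_const.sub (measurable_repPole ε i)).inv).aestronglyMeasurable, ?_⟩
  rw [hasFiniteIntegral_iff_norm]
  refine lt_of_le_of_lt (lintegral_mono fun ω => ENNReal.ofReal_le_ofReal
    (norm_mul_inv_le_cauchyWeight ha (repPole_im_ne_zero hε0 hε1 i ω)
      (abs_repPole_im_le hε0 hε1 i ω) _ lam)) (hg.repMoment_ne_top hε0 hε1 1 i).lt_top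

theorem MemT.integral_repWeight_inl (ha : a ≤ 0) (hg : MemT a g) (hε0 : ∀ r, 0 < ε r)
    (hε1 : ∀ r, ε r ≤ 1) {r : ℕ} (hr : ε (r + 1) ≤ ε r) (lam : ℝ) :
    ∫ ω, repWeight ε g (.inl r) ω * ((lam : ℂ) - repPole ε (.inl r) ω)⁻¹ =
      (2 * Real.pi * Complex.I)⁻¹ * ∫ x, iteratedDeriv (r + 1) g x *
        (cauchyKernel (ε r) lam r x - cauchyKernel (ε (r + 1)) lam r x) := by
  have h := hg.integrable_repWeight_mul ha hε0 hε1 (.inl r) lam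
  rw [Measure.volume_eq_prod] at h ⊢
  rw [integral_prod _ h, ← integral_const_mul]
  refine integral_congr_ae ?_
  filter_upwards [ae_ne_real lam] with x hx
  rw [cauchyKernel_sub_eq_setIntegral hx (hε0 _).le hr, ← mul_assoc, ← integral_const_mul,
    ← integral_indicator (measurableSet_Ioc.diff measurableSet_Ioc)]
  refine integral_congr_ae (.of_forall fun τ => ?_)
  change _ = (cutoffLayer ε r).indicator _ τ
  simp only
  rw [ofReal_sub_repPole, repWeight, poleHeight]
  by_cases hτ : τ ∈ cutoffLayer ε r
  · rw [if_pos hτ, Set.indicator_of_mem hτ, Set.indicator_of_mem hτ, segmentKernel]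
    ring
  · rw [Set.indicator_of_notMem hτ, Set.indicator_of_notMem hτ]
    ring

theorem integral_repWeight_inr (g : ℝ → ℂ) (ε : ℕ → ℝ) (r : ℕ) (b : Bool) (lam : ℝ) :
    ∫ ω, repWeight ε g (.inr (r, b)) ω * ((lam : ℂ) - repPole ε (.inr (r, b)) ω)⁻¹ =
      (2 * Real.pi * Complex.I)⁻¹ * ((endSign b : ℂ) * ∫ x, iteratedDeriv r g x *
        edgeKernel lam r x (stripHeight (endSign b * ε r) x)) := by
  have h1 : ∀ ω : ℝ × ℝ,
      repWeight ε g (.inr (r, b)) ω * ((lam : ℂ) - repPole ε (.inr (r, b)) ω)⁻¹ =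
      ((2 * Real.pi * Complex.I)⁻¹ * ((endSign b : ℂ) * (iteratedDeriv r g ω.1 *
        edgeKernel lam r ω.1 (stripHeight (endSign b * ε r) ω.1)))) *
          (Set.Ioc (0 : ℝ) 1).indicator 1 ω.2 := by
    rintro ⟨x, τ⟩
    rw [ofReal_sub_repPole, repWeight, poleHeight, edgeKernel]
    ring
  have h2 : ∫ τ, (Set.Ioc (0 : ℝ) 1).indicator (1 : ℝ → ℂ) τ = 1 := by
    rw [integral_indicator measurableSet_Ioc]
    simp
  simp only [h1]
  rw [Measure.volume_eq_prod, integral_prod_mul (μ := volume) (ν := volume)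
    (fun x => (2 * Real.pi * Complex.I)⁻¹ * ((endSign b : ℂ) * (iteratedDeriv r g x *
        edgeKernel lam r x (stripHeight (endSign b * ε r) x))))
    ((Set.Ioc (0 : ℝ) 1).indicator 1), h2, mul_one, integral_const_mul,
    integral_const_mul]

theorem MemT.integral_repWeight_inr_add (ha : a ≤ 0) (hg : MemT a g) (hε0 : ∀ r, 0 < ε r)
    (hε1 : ∀ r, ε r ≤ 1) (r : ℕ) (lam : ℝ) :
    ∑ b, ∫ ω, repWeight ε g (.inr (r, b)) ω * ((lam : ℂ) - repPole ε (.inr (r, b)) ω)⁻¹ =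
      (2 * Real.pi * Complex.I)⁻¹ * ∫ x, iteratedDeriv r g x * edgePair (ε r) lam r x := by
  have h : ∀ η : ℝ, η ≠ 0 → |η| ≤ 1 →
      Integrable fun x => iteratedDeriv r g x * edgeKernel lam r x (stripHeight η x) :=
    fun η h0 h1 => hg.integrable_iteratedDeriv_mul ha (by positivity) (measurable_edgeKernel lam r η)
      (.of_forall fun x => norm_edgeKernel_le h0 h1 lam x r)
  have h1 := h (ε r) (hε0 r).ne' (by rw [abs_of_pos (hε0 r)]; exact hε1 r)
  have h2 := h (-ε r) (neg_ne_zero.mpr (hε0 r).ne') (by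
    rw [abs_neg, abs_of_pos (hε0 r)]; exact hε1 r)
  simp only [integral_repWeight_inr, Fintype.sum_bool, edgePair, neg_stripHeight, mul_sub, endSign,
    if_true, Bool.false_eq_true, if_false, one_mul, neg_one_mul]
  rw [integral_sub h1 h2]
  push_cast
  ring

theorem MemT.exists_isCauchyRep_of_cutoffs (ha : a ≤ 0) (hg : MemT a g) (hε0 : ∀ r, 0 < ε r)
    (hε1 : ∀ r, ε r ≤ 1) (hε : Antitone ε)
    (hs : Summable fun r => ε r * (TNorm a (r + 1) g + TNorm a r g)) :
    ∃ (Ω : Type) (_ : MeasurableSpace Ω) (ν : Measure Ω) (z w : Ω → ℂ), IsCauchyRep a g ν z w ∧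
      ∀ K, ∫⁻ ω, ENNReal.ofReal (‖w ω‖ * cauchyWeight a K (z ω)) ∂ν =
        ∑' i, repMoment a ε g K i := by
  refine exists_isCauchyRep_of_countable ha (measurable_repPole ε) (measurable_repWeight ε hg.1)
    (repPole_im_ne_zero hε0 hε1) (abs_repPole_im_le hε0 hε1)
    (fun K _ => hg.tsum_repMoment_ne_top hε0 hε1 hs K) tendsto_disjSum_range_atTop fun lam => ?_
  have hlim : Tendsto (fun r => ε r * TNorm a (r + 1) g) atTop (𝓝 0) := by
    refine squeeze_zero (fun r => mul_nonneg (hε0 r).le (TNorm_nonneg _ _ _)) (fun r => ?_)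
      hs.tendsto_atTop_zero
    have := (hε0 r).le
    have := TNorm_nonneg a r g
    gcongr
    linarith
  have h := (hg.tendsto_sum_integral_mul_edgePair ha hε0 hε1 hlim lam).const_mul
    (2 * Real.pi * Complex.I)⁻¹
  have hpi : (2 * Real.pi * Complex.I : ℂ) ≠ 0 := Complex.two_pi_I_ne_zero
  rw [← mul_assoc, inv_mul_cancel₀ hpi, one_mul] at h
  refine h.congr fun M => ?_
  rw [Finset.sum_disjSum, Finset.sum_product, mul_add, Finset.mul_sum, Finset.mul_sum, add_comm]
  congr 1
  · exact Finset.sum_congr rfl fun r _ =>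
      (hg.integral_repWeight_inl ha hε0 hε1 (hε (Nat.le_succ r)) lam).symm
  · exact Finset.sum_congr rfl fun r _ => (hg.integral_repWeight_inr_add ha hε0 hε1 r lam).symm

/-- The cutoffs: trivial up to index `N`, then so small that the remaining moments sum up to a
multiple of `δ`. -/
noncomputable def cutoff (a : ℝ) (g : ℝ → ℂ) (N : ℕ) (δ : ℝ) (r : ℕ) : ℝ :=
  if r ≤ N then 1 else δ / 2 ^ r / (1 + ∑ q ∈ Finset.range (r + 2), TNorm a q g)

theorem one_le_one_add_sum_TNorm (a : ℝ) (g : ℝ → ℂ) (m : ℕ) :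
    1 ≤ 1 + ∑ q ∈ Finset.range m, TNorm a q g :=
  le_add_of_nonneg_right (Finset.sum_nonneg fun q _ => TNorm_nonneg a q g)

theorem cutoff_pos (a : ℝ) (g : ℝ → ℂ) (N : ℕ) {δ : ℝ} (hδ : 0 < δ) (r : ℕ) :
    0 < cutoff a g N δ r := by
  have := one_le_one_add_sum_TNorm a g (r + 2)
  rw [cutoff]
  split_ifs <;> positivity

theorem cutoff_le_one (a : ℝ) (g : ℝ → ℂ) (N : ℕ) {δ : ℝ} (hδ : 0 < δ) (hδ1 : δ ≤ 1) (r : ℕ) :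
    cutoff a g N δ r ≤ 1 := by
  have h1 := one_le_one_add_sum_TNorm a g (r + 2)
  rw [cutoff]
  split_ifs
  · exact le_rfl
  · exact (div_le_self (by positivity) h1).trans
      ((div_le_self hδ.le (one_le_pow₀ one_le_two)).trans hδ1)

theorem cutoff_antitone (a : ℝ) (g : ℝ → ℂ) (N : ℕ) {δ : ℝ} (hδ : 0 < δ) (hδ1 : δ ≤ 1) :
    Antitone (cutoff a g N δ) := by
  intro r s hrs
  by_cases hr : r ≤ N
  · rw [show cutoff a g N δ r = 1 from if_pos hr]
    exact cutoff_le_one a g N hδ hδ1 s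
  · rw [cutoff, cutoff, if_neg hr, if_neg (by omega)]
    have h1 := one_le_one_add_sum_TNorm a g (r + 2)
    have h2 : ∑ q ∈ Finset.range (r + 2), TNorm a q g ≤ ∑ q ∈ Finset.range (s + 2), TNorm a q g :=
      Finset.sum_le_sum_of_subset_of_nonneg (Finset.range_mono (by omega))
        fun q _ _ => TNorm_nonneg a q g
    gcongr
    exact one_le_two

theorem cutoff_mul_le (a : ℝ) (g : ℝ → ℂ) (N : ℕ) {δ : ℝ} (hδ : 0 < δ) (r : ℕ) :
    cutoff a g N δ r * (TNorm a (r + 1) g + TNorm a r g) ≤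
      (if r ∈ Finset.range (N + 1) then TNorm a (r + 1) g + TNorm a r g else 0) +
        δ * (1 / 2) ^ r := by
  have h0 : 0 ≤ δ * (1 / 2) ^ r := by positivity
  rw [cutoff]
  by_cases hr : r ≤ N
  · rw [if_pos hr, if_pos (Finset.mem_range.mpr (by omega)), one_mul]
    linarith
  · have h1 := one_le_one_add_sum_TNorm a g (r + 2)
    rw [if_neg hr, if_neg (by simp; omega), zero_add, one_div_pow, mul_one_div, div_mul_eq_mul_div]
    refine div_le_of_le_mul₀ (by linarith) (by positivity) ?_
    refine mul_le_mul_of_nonneg_left ?_ (by positivity)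
    rw [Finset.sum_range_succ, Finset.sum_range_succ]
    have : 0 ≤ ∑ q ∈ Finset.range r, TNorm a q g := Finset.sum_nonneg fun q _ => TNorm_nonneg a q g
    linarith

theorem MemT.exists_isCauchyRep (ha : a ≤ 0) (hg : MemT a g) (N : ℕ) {δ : ℝ} (hδ : 0 < δ)
    (hδ1 : δ ≤ 1) :
    ∃ (Ω : Type) (_ : MeasurableSpace Ω) (ν : Measure Ω) (z w : Ω → ℂ), IsCauchyRep a g ν z w ∧
      ∀ K ≤ N, ∫⁻ ω, ENNReal.ofReal (‖w ω‖ * cauchyWeight a K (z ω)) ∂ν ≤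
        ENNReal.ofReal (4 * (∑ r ∈ Finset.range (N + 2), TNorm a r g) + 4 * δ) := by
  have hgeo : Summable fun r : ℕ => δ * (1 / 2 : ℝ) ^ r := summable_geometric_two.mul_left δ
  have hfin : Summable fun r => if r ∈ Finset.range (N + 1) then TNorm a (r + 1) g + TNorm a r g
      else 0 := summable_of_ne_finset_zero (s := Finset.range (N + 1)) fun r hr => if_neg hr
  have hs : Summable fun r => cutoff a g N δ r * (TNorm a (r + 1) g + TNorm a r g) :=
    Summable.of_nonneg_of_le (fun r => mul_nonneg (cutoff_pos a g N hδ r).le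
      (add_nonneg (TNorm_nonneg _ _ _) (TNorm_nonneg _ _ _))) (cutoff_mul_le a g N hδ)
      (hfin.add hgeo)
  obtain ⟨Ω, mΩ, ν, z, w, h, hK⟩ := hg.exists_isCauchyRep_of_cutoffs ha (cutoff_pos a g N hδ)
    (cutoff_le_one a g N hδ hδ1) (cutoff_antitone a g N hδ hδ1) hs
  refine ⟨Ω, mΩ, ν, z, w, h, fun K hKN => ?_⟩
  rw [hK]
  refine (hg.tsum_repMoment_le (cutoff_pos a g N hδ) (cutoff_le_one a g N hδ hδ1) hs hKN
    fun r hr => if_pos hr).trans (ENNReal.ofReal_le_ofReal ?_)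
  have h1 := hs.tsum_le_tsum (cutoff_mul_le a g N hδ) (hfin.add hgeo)
  rw [hfin.tsum_add hgeo, tsum_mul_left, tsum_geometric_two,
    tsum_eq_sum (s := Finset.range (N + 1)) fun r hr => if_neg hr] at h1
  have h2 : ∑ r ∈ Finset.range (N + 1), (if r ∈ Finset.range (N + 1) then
      TNorm a (r + 1) g + TNorm a r g else 0) ≤ 2 * ∑ r ∈ Finset.range (N + 2), TNorm a r g := by
    rw [Finset.sum_congr rfl fun r hr => if_pos hr, Finset.sum_add_distrib, two_mul]
    refine add_le_add ?_ ?_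
    · rw [Finset.sum_range_succ' _ (N + 1)]
      linarith [TNorm_nonneg a 0 g]
    · rw [Finset.sum_range_succ _ (N + 1)]
      linarith [TNorm_nonneg a (N + 1) g]
  linarith

end Existence

/-! ### Changing the order by powers of `x + i` -/

theorem tWeight_shift_le {f : ℝ → ℂ} (hf : ContDiff ℝ (⊤ : ℕ∞) f) (α : ℝ) (s : ℤ) (r : ℕ)
    (x : ℝ) :
    tWeight (α + s) r (fun x => ((x : ℂ) - -Complex.I) ^ s * f x) x ≤
      ∑ i ∈ Finset.range (r + 1),
        (r.choose i * ((s.natAbs : ℝ) + r + 1) ^ r) * tWeight α (r - i) f x := by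
  have hmul : (fun x : ℝ => ((x : ℂ) - -Complex.I) ^ s * f x) =
      (fun x : ℝ => ((x : ℂ) - -Complex.I) ^ s) * f := rfl
  have hle : ((r : ℕ) : WithTop ℕ∞) ≤ ((⊤ : ℕ∞) : WithTop ℕ∞) := by exact_mod_cast le_top
  have hb := jb_pos x
  rw [tWeight, hmul, iteratedDeriv_mul
    (((contDiff_zpow_sub neg_I_im_ne_zero _).of_le hle).contDiffAt) (hf.of_le hle).contDiffAt]
  refine (mul_le_mul_of_nonneg_right (norm_sum_le _ _) (by positivity)).trans ?_
  rw [Finset.sum_mul]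
  refine Finset.sum_le_sum fun i hi => ?_
  have hir : i ≤ r := by
    have := Finset.mem_range.mp hi
    omega
  have h1 := norm_iteratedDeriv_zpow_sub_le (P := s.natAbs) (m := s) neg_I_im_ne_zero
    (by simp) hir x
  rw [norm_sub_neg_I] at h1
  have h2 : jb x ^ (s - i) * jb x ^ ((r : ℝ) - (α + s) - 1) =
      jb x ^ (((r - i : ℕ) : ℝ) - α - 1) := by
    rw [← Real.rpow_intCast, ← Real.rpow_add hb]
    congr 1
    push_cast [hir]
    ring
  rw [norm_mul, norm_mul, Complex.norm_natCast, tWeight, ← h2]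
  calc _ ≤ (r.choose i : ℝ) * (((s.natAbs : ℝ) + r + 1) ^ r * jb x ^ (s - i)) *
        ‖iteratedDeriv (r - i) f x‖ * jb x ^ ((r : ℝ) - (α + s) - 1) := by
        gcongr
    _ = _ := by ring

theorem MemT.shift {f : ℝ → ℂ} {α : ℝ} (hf : MemT α f) (s : ℤ) :
    MemT (α + s) (fun x => ((x : ℂ) - -Complex.I) ^ s * f x) := by
  have hs : ContDiff ℝ (⊤ : ℕ∞) fun x : ℝ => ((x : ℂ) - -Complex.I) ^ s * f x :=
    (contDiff_zpow_sub neg_I_im_ne_zero s).mul hf.1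
  refine ⟨hs, fun r => ?_⟩
  have hle : ((r : ℕ) : WithTop ℕ∞) ≤ ((⊤ : ℕ∞) : WithTop ℕ∞) := by exact_mod_cast le_top
  refine Integrable.mono' (integrable_finsetSum (Finset.range (r + 1)) fun i _ =>
    (hf.2 (r - i)).const_mul (r.choose i * ((s.natAbs : ℝ) + r + 1) ^ r))
    (Continuous.aestronglyMeasurable ?_) (Eventually.of_forall fun x => ?_)
  · exact ((hs.continuous_iteratedDeriv r hle).norm).mul
      (continuous_jb.rpow_const fun x => Or.inl (jb_ne_zero x))
  · rw [Real.norm_of_nonneg (tWeight_nonneg _ _ _ _)]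
    exact tWeight_shift_le hf.1 α s r x

/-- The constant of `MemT.sum_TNorm_shift_le`. -/
noncomputable def shiftConst (P M : ℕ) : ℝ :=
  ∑ r ∈ Finset.range M, 2 ^ r * ((P : ℝ) + r + 1) ^ r

theorem shiftConst_nonneg (P M : ℕ) : 0 ≤ shiftConst P M :=
  Finset.sum_nonneg fun _ _ => by positivity

theorem MemT.sum_TNorm_shift_le {f : ℝ → ℂ} {α : ℝ} (hf : MemT α f) (s : ℤ) (M : ℕ) :
    ∑ r ∈ Finset.range M, TNorm (α + s) r (fun x => ((x : ℂ) - -Complex.I) ^ s * f x) ≤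
      shiftConst s.natAbs M * ∑ r ∈ Finset.range M, TNorm α r f := by
  rw [shiftConst, Finset.sum_mul]
  refine Finset.sum_le_sum fun r hr => ?_
  have hrM := Finset.mem_range.mp hr
  have hint : ∀ i ∈ Finset.range (r + 1), Integrable fun x =>
      (r.choose i * ((s.natAbs : ℝ) + r + 1) ^ r) * tWeight α (r - i) f x := fun i _ =>
    (hf.2 (r - i)).const_mul _
  calc _ ≤ ∫ x, ∑ i ∈ Finset.range (r + 1),
        (r.choose i * ((s.natAbs : ℝ) + r + 1) ^ r) * tWeight α (r - i) f x :=
        integral_mono ((hf.shift s).2 r) (integrable_finsetSum _ hint)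
          fun x => tWeight_shift_le hf.1 α s r x
    _ = ∑ i ∈ Finset.range (r + 1),
        (r.choose i * ((s.natAbs : ℝ) + r + 1) ^ r) * TNorm α (r - i) f := by
        rw [integral_finsetSum _ hint]
        simp only [integral_const_mul, TNorm]
    _ ≤ ∑ i ∈ Finset.range (r + 1), (r.choose i * ((s.natAbs : ℝ) + r + 1) ^ r) *
        ∑ q ∈ Finset.range M, TNorm α q f := by
        refine Finset.sum_le_sum fun i _ => mul_le_mul_of_nonneg_left ?_ (by positivity)
        exact Finset.single_le_sum (f := fun q => TNorm α q f) (fun q _ => TNorm_nonneg _ _ _)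
          (Finset.mem_range.mpr (by omega))
    _ = _ := by
        rw [← Finset.sum_mul, ← Finset.sum_mul, ← Nat.cast_sum, Nat.sum_range_choose]
        push_cast
        ring

/-! ### Box seminorms of integrals of resolvents -/

theorem MemT.memBox_and_boxNorm_le {a : ℝ} {g : ℝ → ℂ} (ha : a ≤ 0) (hg : MemT a g)
    {n q P : ℕ} {p e : Fin (n + 1) → ℕ} {t : ℝ} (hp : ∀ j, p j ≤ P) (he : ∀ j, e j ≤ 1)
    (ht0 : 0 ≤ t) (ht1 : t ≤ 1) (hE1 : 1 ≤ ∑ j, e j)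
    (hE : (∑ j, e j : ℕ) * t = (∑ j, e j : ℕ) - 1 - a - q) {φ : (Fin (n + 1) → ℝ) → ℂ}
    (hφ : ∀ (Ω : Type) (_ : MeasurableSpace Ω) (ν : Measure Ω) (z w : Ω → ℂ),
      IsCauchyRep a g ν z w → ∀ x, φ x = ∫ ω, w ω * (z ω - -Complex.I) ^ q *
        ∏ j, resolventBlock (p j) (e j) (z ω) (x j) ∂ν) :
    MemBox (fun j => -(p j + e j * t)) φ ∧ ∀ k : Fin (n + 1) → ℕ,
      boxNorm (fun j => -(p j + e j * t)) k φ ≤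
        ENNReal.ofReal (2 ^ q * (∏ j, blockConst P (k j)) *
          (4 * ∑ r ∈ Finset.range (n + (∑ j, k j) + 3), TNorm a r g)) := by
  refine ⟨?_, fun k => ?_⟩
  · obtain ⟨Ω, mΩ, ν, z, w, h, -⟩ := hg.exists_isCauchyRep ha 0 one_pos le_rfl
    rw [funext (hφ Ω mΩ ν z w h)]
    exact ⟨Ω, mΩ, ν, _, h.isBoxRep he ht0 ht1 hE1 hE⟩
  have hc : 0 ≤ 2 ^ q * ∏ j, blockConst P (k j) :=
    mul_nonneg (by positivity) (Finset.prod_nonneg fun j _ => blockConst_nonneg _ _)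
  have hEn : ∑ j, e j ≤ n + 1 := by
    simpa using Finset.sum_le_card_nsmul Finset.univ e 1 fun j _ => he j
  have key : ∀ δ ∈ Set.Ioc (0 : ℝ) 1, boxNorm (fun j => -(p j + e j * t)) k φ ≤
      ENNReal.ofReal (2 ^ q * (∏ j, blockConst P (k j)) *
        (4 * ∑ r ∈ Finset.range (n + (∑ j, k j) + 3), TNorm a r g + 4 * δ)) := by
    intro δ hδ
    obtain ⟨Ω, mΩ, ν, z, w, h, hb⟩ :=
      hg.exists_isCauchyRep ha (n + (∑ j, k j) + 1) hδ.1 hδ.2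
    rw [funext (hφ Ω mΩ ν z w h), ENNReal.ofReal_mul hc]
    refine (h.boxNorm_le hp he ht0 ht1 hE1 hE k).trans ?_
    gcongr
    exact hb _ (by omega)
  have hlim : Tendsto (fun δ : ℝ => ENNReal.ofReal (2 ^ q * (∏ j, blockConst P (k j)) *
        (4 * ∑ r ∈ Finset.range (n + (∑ j, k j) + 3), TNorm a r g + 4 * δ))) (𝓝[>] 0)
      (𝓝 (ENNReal.ofReal (2 ^ q * (∏ j, blockConst P (k j)) *
        (4 * ∑ r ∈ Finset.range (n + (∑ j, k j) + 3), TNorm a r g + 4 * 0)))) := by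
    refine ENNReal.tendsto_ofReal ?_
    refine (Continuous.tendsto ?_ (0 : ℝ)).mono_left nhdsWithin_le_nhds
    fun_prop
  rw [mul_zero, add_zero] at hlim
  refine ge_of_tendsto hlim ?_
  filter_upwards [Ioc_mem_nhdsGT one_pos] with δ hδ using key δ hδ

/-- The constant of `MemT.memBox_and_boxNorm_le_of_shift`. -/
noncomputable def boxConst (s : ℤ) (q P : ℕ) {n : ℕ} (k : Fin (n + 1) → ℕ) : ℝ :=
  2 ^ q * (∏ j, blockConst P (k j)) * (4 * shiftConst s.natAbs (n + (∑ j, k j) + 3))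

theorem boxConst_nonneg (s : ℤ) (q P : ℕ) {n : ℕ} (k : Fin (n + 1) → ℕ) :
    0 ≤ boxConst s q P k :=
  mul_nonneg (mul_nonneg (by positivity) (Finset.prod_nonneg fun j _ => blockConst_nonneg _ _))
    (mul_nonneg zero_le_four (shiftConst_nonneg _ _))

theorem MemT.memBox_and_boxNorm_le_of_shift {α : ℝ} {f : ℝ → ℂ} (hf : MemT α f) {s : ℤ}
    (hs : α + s ≤ 0) {n q P : ℕ} {p e : Fin (n + 1) → ℕ} {t : ℝ} (hp : ∀ j, p j ≤ P)
    (he : ∀ j, e j ≤ 1) (ht0 : 0 ≤ t) (ht1 : t ≤ 1) (hE1 : 1 ≤ ∑ j, e j)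
    (hE : (∑ j, e j : ℕ) * t = (∑ j, e j : ℕ) - 1 - (α + s) - q) {φ : (Fin (n + 1) → ℝ) → ℂ}
    (hφ : ∀ (Ω : Type) (_ : MeasurableSpace Ω) (ν : Measure Ω) (z w : Ω → ℂ),
      IsCauchyRep (α + s) (fun x => ((x : ℂ) - -Complex.I) ^ s * f x) ν z w →
      ∀ x, φ x = ∫ ω, w ω * (z ω - -Complex.I) ^ q *
        ∏ j, resolventBlock (p j) (e j) (z ω) (x j) ∂ν) :
    MemBox (fun j => -(p j + e j * t)) φ ∧ ∀ k : Fin (n + 1) → ℕ,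
      boxNorm (fun j => -(p j + e j * t)) k φ ≤ ENNReal.ofReal
        (boxConst s q P k * ∑ r ∈ Finset.range (n + (∑ j, k j) + 3), TNorm α r f) := by
  obtain ⟨h1, h2⟩ := (hf.shift s).memBox_and_boxNorm_le hs hp he ht0 ht1 hE1 hE hφ
  refine ⟨h1, fun k => (h2 k).trans (ENNReal.ofReal_le_ofReal ?_)⟩
  have hc : 0 ≤ 2 ^ q * ∏ j, blockConst P (k j) :=
    mul_nonneg (by positivity) (Finset.prod_nonneg fun j _ => blockConst_nonneg _ _)
  rw [boxConst, mul_assoc (2 ^ q * ∏ j, blockConst P (k j)), mul_assoc (4 : ℝ)]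
  gcongr
  exact hf.sum_TNorm_shift_le s _

theorem zpow_mul_zpow_shift (s : ℤ) (f : ℝ → ℂ) :
    (fun x : ℝ => ((x : ℂ) - -Complex.I) ^ (-s) * (((x : ℂ) - -Complex.I) ^ s * f x)) = f := by
  funext x
  rw [← mul_assoc, ← zpow_add₀ (sub_neg_I_ne_zero x), neg_add_cancel, zpow_zero, one_mul]

theorem IsDivDiffMul.iterate_div {g : ℝ → ℂ} {G : (m : ℕ) → (Fin (m + 1) → ℝ) → ℂ}
    (hG : IsDivDiffMul g G) (s : ℕ) :
    IsDivDiffMul (fun x => ((x : ℂ) - -Complex.I) ^ (-(s : ℤ)) * g x) (divSeq^[s] G) := by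
  induction s with
  | zero => simpa using hG
  | succ s ih =>
    rw [Function.iterate_succ_apply']
    convert ih.div using 2 with x
    rw [← mul_assoc, ← zpow_neg_one, ← zpow_add₀ (sub_neg_I_ne_zero x)]
    congr 2
    push_cast
    ring

theorem IsDivDiffMul.iterate_mul {g : ℝ → ℂ} {G : (m : ℕ) → (Fin (m + 1) → ℝ) → ℂ}
    (hG : IsDivDiffMul g G) (s : ℕ) :
    IsDivDiffMul (fun x => ((x : ℂ) - -Complex.I) ^ s * g x) (mulSeq^[s] G) := by
  induction s with
  | zero => simpa using hG
  | succ s ih =>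
    rw [Function.iterate_succ_apply']
    convert ih.mul using 2 with x
    ring

theorem prod_univ_ite_le {M : Type*} [CommMonoid M] {n : ℕ} (l : Fin (n + 1))
    (h : Fin (n + 1) → M) :
    ∏ j, (if j ≤ l then h j else 1) = ∏ j : Fin (l + 1), h (Fin.castLE l.2 j) := by
  rw [← Finset.prod_filter]
  have h1 : Finset.univ.filter (· ≤ l) = Finset.univ.map (Fin.castLEEmb l.2) := by
    ext j
    simp only [Finset.mem_filter, Finset.mem_univ, true_and, Finset.mem_map]
    refine ⟨fun hj => ⟨⟨j, Nat.lt_succ_of_le hj⟩, rfl⟩, ?_⟩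
    rintro ⟨i, rfl⟩
    exact Nat.le_of_lt_succ i.2
  rw [h1, Finset.prod_map]
  rfl

theorem sum_univ_ite_le {n : ℕ} (l : Fin (n + 1)) : ∑ j, (if j ≤ l then 1 else 0) = l.1 + 1 := by
  rw [← Finset.card_filter]
  have := Fin.card_Iic l
  rwa [← Finset.filter_ge_eq_Iic] at this

theorem divTerm_cauchySeq {Ω : Type} [MeasurableSpace Ω] (ν : Measure Ω) (z w : Ω → ℂ) {n : ℕ}
    (τ : Fin (n + 1) × (Fin (n + 1) → ℕ)) (x : Fin (n + 1) → ℝ) :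
    divTerm (cauchySeq ν z w) τ x = ∫ ω, w ω * (z ω - -Complex.I) ^ 0 *
      ∏ j, resolventBlock (τ.2 j) (if j ≤ τ.1 then 1 else 0) (z ω) (x j) ∂ν := by
  rw [divTerm, cauchySeq, ← integral_mul_const]
  congr 1
  funext ω
  have h1 := prod_univ_ite_le τ.1 fun j => ((x j : ℂ) - z ω)⁻¹
  simp only [resolventBlock, Finset.prod_mul_distrib]
  rw [← h1, pow_zero, mul_one, mul_assoc]
  congr 1
  rw [mul_comm]
  congr 1
  refine Finset.prod_congr rfl fun j _ => ?_
  split_ifs <;> simp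

theorem exists_box_decomposition_of_pos {n : ℕ} {α : ℝ} (hα0 : 0 < α) (hα : α ≤ n) {f : ℝ → ℂ}
    {F : (m : ℕ) → (Fin (m + 1) → ℝ) → ℂ} (hf : MemT α f) (hF : IsDivDiff f F) :
    ∃ β : Fin (n + 1) → ℝ, (∀ j, β j ≤ 0) ∧ ∑ j, β j = α - n ∧ MemBox β (F n) ∧
      ∀ k, boxNorm β k (F n) ≤ ENNReal.ofReal (boxConst (-(⌈α⌉₊ : ℤ)) ⌈α⌉₊ 0 k *
        ∑ r ∈ Finset.range (n + (∑ j, k j) + 3), TNorm α r f) := by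
  have hq : ⌈α⌉₊ ≤ n := Nat.ceil_le.mpr hα
  have ha : α + ((-(⌈α⌉₊ : ℤ) : ℤ) : ℝ) ≤ 0 := by
    push_cast
    linarith [Nat.le_ceil α]
  have hn : (0 : ℝ) < (n : ℝ) + 1 := by positivity
  have ht0 : 0 ≤ ((n : ℝ) - α) / (n + 1) := div_nonneg (by linarith) hn.le
  have ht1 : ((n : ℝ) - α) / (n + 1) ≤ 1 := (div_le_one hn).mpr (by linarith)
  obtain ⟨h1, h2⟩ := hf.memBox_and_boxNorm_le_of_shift ha (n := n) (q := ⌈α⌉₊) (P := 0)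
    (p := fun _ => 0) (e := fun _ => 1) (t := ((n : ℝ) - α) / (n + 1)) (φ := F n)
    (fun _ => le_rfl) (fun _ => le_rfl) ht0 ht1 (by simp) (by
      simp only [Finset.sum_const, Finset.card_univ, Fintype.card_fin, smul_eq_mul, mul_one]
      push_cast
      rw [mul_div_cancel₀ _ hn.ne']
      ring) fun Ω _ ν z w h x => by
      have h3 := (h.isDivDiffMul ha).iterate_mul ⌈α⌉₊
      have h4 := zpow_mul_zpow_shift (-(⌈α⌉₊ : ℤ)) f
      simp only [neg_neg, zpow_natCast] at h4
      rw [h4] at h3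
      rw [hF.eq_of_isDivDiffMul h3 n, h.iterate_mulSeq ha hq]
      simp [resolventBlock]
  refine ⟨_, fun j => ?_, ?_, h1, h2⟩
  · simpa using ht0
  · simp only [Nat.cast_zero, Nat.cast_one, zero_add, one_mul, Finset.sum_const,
      Finset.card_univ, Fintype.card_fin, nsmul_eq_mul]
    push_cast
    rw [mul_neg, mul_div_cancel₀ _ hn.ne']
    ring

theorem memBox_and_boxNorm_divTerm_le {n : ℕ} {α : ℝ} {s : ℕ} (hs0 : α + s ≤ 0)
    (hs1 : -1 ≤ α + s) {f : ℝ → ℂ} (hf : MemT α f) {G : (m : ℕ) → (Fin (m + 1) → ℝ) → ℂ}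
    (hG : IsDivDiffMul (fun x => ((x : ℂ) - -Complex.I) ^ (s : ℤ) * f x) G)
    {τ : Fin (n + 1) × (Fin (n + 1) → ℕ)} (hτ : ∑ j, τ.2 j + τ.1 = s + n) :
    ∃ β : Fin (n + 1) → ℝ, (∀ j, β j ≤ 0) ∧ ∑ j, β j = α - n ∧ MemBox β (divTerm G τ) ∧
      ∀ k, boxNorm β k (divTerm G τ) ≤ ENNReal.ofReal (boxConst (s : ℤ) 0 (s + n) k *
        ∑ r ∈ Finset.range (n + (∑ j, k j) + 3), TNorm α r f) := by
  have hs0' : α + ((s : ℤ) : ℝ) ≤ 0 := by exact_mod_cast hs0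
  have hl : (0 : ℝ) < ((τ.1 : ℕ) : ℝ) + 1 := by positivity
  have hl0 : (0 : ℝ) ≤ ((τ.1 : ℕ) : ℝ) := by positivity
  have hlt := mul_div_cancel₀ (((τ.1 : ℕ) : ℝ) - (α + s)) hl.ne'
  set t : ℝ := (((τ.1 : ℕ) : ℝ) - (α + s)) / (((τ.1 : ℕ) : ℝ) + 1) with ht
  have ht0 : 0 ≤ t := div_nonneg (by linarith) hl.le
  have ht1 : t ≤ 1 := (div_le_one hl).mpr (by linarith)
  have hE := sum_univ_ite_le τ.1
  obtain ⟨h1, h2⟩ := hf.memBox_and_boxNorm_le_of_shift hs0' (n := n) (q := 0) (P := s + n)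
    (p := τ.2) (e := fun j => if j ≤ τ.1 then 1 else 0) (t := t) (φ := divTerm G τ)
    (fun j => (Finset.single_le_sum (fun _ _ => Nat.zero_le _) (Finset.mem_univ j)).trans
      (by omega)) (fun j => by split_ifs <;> simp) ht0 ht1 (by omega) (by
      rw [hE]
      push_cast
      linarith) fun Ω _ ν z w h x => by
      rw [← divTerm_cauchySeq, divTerm, divTerm, hG.unique (h.isDivDiffMul hs0')]
  refine ⟨_, fun j => ?_, ?_, h1, h2⟩
  · exact neg_nonpos.mpr (by positivity)
  · rw [Finset.sum_neg_distrib, Finset.sum_add_distrib, ← Finset.sum_mul, ← Nat.cast_sum,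
      ← Nat.cast_sum, hE]
    have h3 : ((∑ j, τ.2 j : ℕ) : ℝ) + (τ.1 : ℕ) = s + n := by exact_mod_cast hτ
    push_cast at h3 ⊢
    linarith

theorem exists_box_decomposition_of_nonpos (n : ℕ) {α : ℝ} (hα0 : α ≤ 0) {f : ℝ → ℂ}
    {F : (m : ℕ) → (Fin (m + 1) → ℝ) → ℂ} (hf : MemT α f) (hF : IsDivDiff f F) :
    ∃ (L : ℕ) (β : Fin L → Fin (n + 1) → ℝ) (φ : Fin L → ((Fin (n + 1) → ℝ) → ℂ)),
      (∀ i j, β i j ≤ 0) ∧ (∀ i, ∑ j, β i j = α - n) ∧ (∀ i, MemBox (β i) (φ i)) ∧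
      (∀ x, F n x = ∑ i, φ i x) ∧ ∀ i k, boxNorm (β i) k (φ i) ≤
        ENNReal.ofReal (boxConst (⌊-α⌋₊ : ℤ) 0 (⌊-α⌋₊ + n) k *
          ∑ r ∈ Finset.range (n + (∑ j, k j) + 3), TNorm α r f) := by
  have h0 : α + (⌊-α⌋₊ : ℕ) ≤ 0 := by linarith [Nat.floor_le (neg_nonneg.mpr hα0)]
  have h1 : -1 ≤ α + (⌊-α⌋₊ : ℕ) := by linarith [Nat.lt_floor_add_one (-α)]
  have h0' : α + ((⌊-α⌋₊ : ℤ) : ℝ) ≤ 0 := by exact_mod_cast h0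
  obtain ⟨Ω, _, ν, z, w, h, -⟩ :=
    (hf.shift (⌊-α⌋₊ : ℤ)).exists_isCauchyRep h0' 0 one_pos le_rfl
  have hG := h.isDivDiffMul h0'
  have hD := hG.iterate_div ⌊-α⌋₊
  rw [zpow_mul_zpow_shift] at hD
  obtain ⟨T, hT, hTx⟩ := exists_divTerm_sum (cauchySeq ν z w) ⌊-α⌋₊ n
  choose β hβ0 hβ hB hN using fun i : Fin T.length =>
    memBox_and_boxNorm_divTerm_le h0 h1 hf hG (hT (T.get i) (T.get_mem i))
  refine ⟨T.length, β, fun i => divTerm (cauchySeq ν z w) (T.get i), hβ0, hβ, hB, fun x => ?_, hN⟩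
  rw [hF.eq_of_isDivDiffMul hD n, hTx, ← Fin.sum_univ_fun_getElem]
  rfl

open scoped ENNReal in
/-- Let `n ≥ 0`, `α ≤ n` real, and `f ∈ T^α(ℝ)`. Then there exist
finitely many tuples `β⁽¹⁾, …, β⁽ᴸ⁾ ∈ ℝ^{n+1}` with `β⁽ⁱ⁾_j ≤ 0` for all `j` and
`Σ_j β⁽ⁱ⁾_j = α − n`, and functions `φ_i ∈ S^{β⁽ⁱ⁾_0}(ℝ) ⊠ᵢ ⋯ ⊠ᵢ S^{β⁽ⁱ⁾_n}(ℝ)` with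
`f^{[n]} = φ_1 + ⋯ + φ_L`, where for all `k_0, …, k_n ≥ 0` each `φ_i` satisfies
`‖φ_i‖_{k_0,…,k_n} ≤ C(k) · Σ_{r=0}^{n+k_0+⋯+k_n+2} ‖f‖_{T^α,r}` with `C(k)`
independent of `f`. -/
theorem stmt5 (n : ℕ) (α : ℝ) (hα : α ≤ (n : ℝ)) :
    ∃ C : (Fin (n + 1) → ℕ) → ℝ, (∀ k, 0 ≤ C k) ∧
      ∀ (f : ℝ → ℂ) (F : (m : ℕ) → (Fin (m + 1) → ℝ) → ℂ),
        MemT α f → IsDivDiff f F →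
        ∃ (L : ℕ) (β : Fin L → Fin (n + 1) → ℝ)
          (φ : Fin L → ((Fin (n + 1) → ℝ) → ℂ)),
          (∀ i j, β i j ≤ 0) ∧
          (∀ i, ∑ j, β i j = α - n) ∧
          (∀ i, MemBox (β i) (φ i)) ∧
          (∀ lam, F n lam = ∑ i, φ i lam) ∧
          (∀ (i : Fin L) (k : Fin (n + 1) → ℕ),
            boxNorm (β i) k (φ i) ≤
              ENNReal.ofReal (C k * ∑ r ∈ Finset.range (n + (∑ j, k j) + 3), TNorm α r f)) := by
  rcases lt_or_ge 0 α with hα0 | hα0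
  · refine ⟨fun k => boxConst (-(⌈α⌉₊ : ℤ)) ⌈α⌉₊ 0 k, fun k => boxConst_nonneg _ _ _ _,
      fun f F hf hF => ?_⟩
    obtain ⟨β, h0, h1, hB, hN⟩ := exists_box_decomposition_of_pos hα0 hα hf hF
    exact ⟨1, fun _ => β, fun _ => F n, fun _ => h0, fun _ => h1, fun _ => hB, by simp,
      fun _ => hN⟩
  · exact ⟨fun k => boxConst (⌊-α⌋₊ : ℤ) 0 (⌊-α⌋₊ + n) k, fun k => boxConst_nonneg _ _ _ _,
      fun f F hf hF => exists_box_decomposition_of_nonpos n hα0 hf hF⟩
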